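/- arXiv:1903.12315 — 3 statements merged into one kernel-verified Lean document; each statement's English description precedes it below -/
import Mathlib

section
/- Let α ∈ (0,1], δ ∈ (-1,1) (with δ = 0 if α = 1), and let Y be a real-valued random variable. Then Y ~ S_α(δ) if and only if E[A_{α,δ} f(Y)] = 0 for every f in the Schwartz space of smooth rapidly decaying functions, where A_{α,δ} f(x) = L^{α,δ} f(x) − (1/α) x f'(x). -/
open MeasureTheory Real Filter Set
open scoped Topology

noncomputable section

/-- Normalizing constant `d_α`. -/
def dconst (α : ℝ) : ℝ :=
  if α = 1 then 2 / π else -1 / (Real.Gamma (-α) * Real.cos (π * α / 2))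

/-- Density of the Lévy measure `ν_{α,δ}` with respect to Lebesgue measure. -/
def nuDens (α δ : ℝ) (u : ℝ) : ℝ :=
  dconst α * (if 0 < u then (1 + δ) / 2 * u ^ (-1 - α)
    else if u < 0 then (1 - δ) / 2 * |u| ^ (-1 - α) else 0)

/-- Generator `L^{α,δ}` for `α ∈ (0,1)`. -/
def Lop (α δ : ℝ) (f : ℝ → ℝ) (x : ℝ) : ℝ :=
  ∫ u, (f (x + u) - f x) * nuDens α δ u

/-- Generator `L^{1,0}` (note `ν_{1,0}(du) = (2/π)|u|⁻²/2 du = 1/(π u²) du`). -/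
def Lop1 (f : ℝ → ℝ) (x : ℝ) : ℝ :=
  ∫ u, (f (x + u) - f x - (if |u| ≤ 1 then u * deriv f x else 0)) * (1 / (π * u ^ 2))

/-- Combined generator. -/
def LopA (α δ : ℝ) (f : ℝ → ℝ) (x : ℝ) : ℝ :=
  if α = 1 then Lop1 f x else Lop α δ f x

/-- Characteristic function of the strictly `α`-stable law at time `t`. -/
def stableCF (α δ t l : ℝ) : ℂ :=
  if α = 1 then Complex.exp (↑(-(t * |l|)) : ℂ)
  else Complex.exp ((↑(-(t * |l| ^ α)) : ℂ) *
    (1 - Complex.I * (δ : ℂ) * ((Real.sign l : ℝ) : ℂ) * ((Real.tan (π * α / 2) : ℝ) : ℂ)))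

/-- `μ` is the strictly `α`-stable law `S_α(δ)`. -/
def IsStableLaw (α δ : ℝ) (μ : Measure ℝ) : Prop :=
  ∀ l : ℝ, (∫ x, Complex.exp (Complex.I * (l : ℂ) * (x : ℂ)) ∂μ) = stableCF α δ 1 l

/-- The class `H_β`. -/
def memHbeta (β : ℝ) (h : ℝ → ℝ) : Prop :=
  ∀ x y : ℝ, |h x - h y| ≤ min |x - y| (|x - y| ^ β)

/-- The distance `d_{W_β}`. -/
def dWbeta (β : ℝ) (μ ν : Measure ℝ) : ℝ :=
  sSup { r | ∃ h : ℝ → ℝ, memHbeta β h ∧ r = |(∫ x, h x ∂μ) - ∫ x, h x ∂ν| }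

/-- The Kolmogorov distance. -/
def dKol (μ ν : Measure ℝ) : ℝ :=
  sSup { r | ∃ x : ℝ, r = |(μ (Set.Iic x)).toReal - (ν (Set.Iic x)).toReal| }

/-- The solution of Stein's equation. -/
def steinSol (α : ℝ) (p h : ℝ → ℝ) (x : ℝ) : ℝ :=
  -∫ t in Set.Ioi (0:ℝ), ∫ y, p y *
    (h ((1 - Real.exp (-t)) ^ (1/α) * y + Real.exp (-t/α) * x) - h y)

namespace StableAux

lemma integrableOn_min_rpow {p α : ℝ} (hα : 0 < α) (hp : α < p) :
    IntegrableOn (fun t : ℝ => min 1 (t ^ p) * t ^ (-1 - α)) (Ioi 0) := by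
  have hm : Measurable (fun t : ℝ => min 1 (t ^ p) * t ^ (-1 - α)) := by fun_prop
  rw [← Ioc_union_Ioi_eq_Ioi (zero_le_one' ℝ)]
  refine IntegrableOn.union ?_ ?_
  · have h := (intervalIntegral.intervalIntegrable_rpow' (a := 0) (b := 1)
      (show -1 < p - 1 - α by linarith)).1
    refine Integrable.mono' h hm.aestronglyMeasurable ?_
    refine (ae_restrict_iff' measurableSet_Ioc).2 (ae_of_all _ fun t ht => ?_)
    have ht0 : 0 < t := ht.1
    rw [norm_of_nonneg (by positivity), show p - 1 - α = p + (-1 - α) by ring, rpow_add ht0]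
    gcongr
    exact min_le_right _ _
  · have h := integrableOn_Ioi_rpow_of_lt (show -1 - α < -1 by linarith) zero_lt_one
    refine Integrable.mono' h hm.aestronglyMeasurable ?_
    refine (ae_restrict_iff' measurableSet_Ioi).2 (ae_of_all _ fun t ht => ?_)
    have ht0 : 0 < t := lt_trans zero_lt_one ht
    rw [norm_of_nonneg (by positivity)]
    calc _ ≤ 1 * t ^ (-1 - α) := by gcongr; exact min_le_left _ _
      _ = _ := one_mul _

lemma integrable_min_abs {p α : ℝ} (hα : 0 < α) (hp : α < p) :
    Integrable (fun t : ℝ => min 1 (|t| ^ p) * |t| ^ (-1 - α)) := by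
  have h := integrableOn_min_rpow hα hp
  have h1 : IntegrableOn (fun t : ℝ => min 1 (|t| ^ p) * |t| ^ (-1 - α)) (Ioi 0) := by
    refine h.congr_fun (fun t ht => ?_) measurableSet_Ioi
    simp only [abs_of_pos (show (0:ℝ) < t from ht)]
  have h2 : IntegrableOn (fun t : ℝ => min 1 (|t| ^ p) * |t| ^ (-1 - α)) (Iic 0) := by
    rw [integrableOn_Iic_iff_integrableOn_Iio]
    have := h1.comp_neg
    simpa using this
  have := h2.union h1
  rwa [Iic_union_Ioi, integrableOn_univ] at this

lemma norm_exp_le_one {z : ℂ} (hz : z.re ≤ 0) : ‖Complex.exp z‖ ≤ 1 := by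
  rw [Complex.norm_exp]; exact Real.exp_le_one_iff.2 hz

lemma norm_exp_sub_one_le_min {z : ℂ} (hz : z.re ≤ 0) :
    ‖Complex.exp z - 1‖ ≤ 2 * min 1 ‖z‖ := by
  have h2 : ‖Complex.exp z - 1‖ ≤ 2 := by
    calc _ ≤ ‖Complex.exp z‖ + ‖(1:ℂ)‖ := norm_sub_le _ _
      _ ≤ 1 + 1 := by gcongr; exact norm_exp_le_one hz; simp
      _ = 2 := by norm_num
  rcases le_total ‖z‖ 1 with h | h
  · rw [min_eq_right h]; exact Complex.norm_exp_sub_one_le h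
  · rw [min_eq_left h]; linarith

lemma norm_exp_sub_one_sub_le {z : ℂ} (hz : z.re ≤ 0) :
    ‖Complex.exp z - 1 - z‖ ≤ 3 * ‖z‖ ^ 2 := by
  rcases le_total ‖z‖ 1 with h | h
  · have := Complex.norm_exp_sub_one_sub_id_le h
    nlinarith [sq_nonneg ‖z‖]
  · have h1 := norm_exp_sub_one_le_min hz
    rw [min_eq_left h] at h1
    calc _ ≤ ‖Complex.exp z - 1‖ + ‖z‖ := norm_sub_le _ _
      _ ≤ 2 + ‖z‖ := by linarith
      _ ≤ _ := by nlinarith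

lemma laplace_gamma {α : ℝ} (hα1 : α < 1) {r : ℂ} (hr : 0 < r.re) :
    ∫ t in Ioi (0:ℝ), ((t ^ (-α) : ℝ) : ℂ) * Complex.exp (-(r * t))
      = (Real.Gamma (1 - α) : ℂ) * r ^ ((α : ℂ) - 1) := by
  set ν : Measure ℝ := (volume.restrict (Ioi 0)).withDensity
    (fun t => ENNReal.ofReal (t ^ (-α))) with hν
  have hmeas : Measurable (fun t : ℝ => ENNReal.ofReal (t ^ (-α))) := by fun_prop
  have hInt : ∀ z : ℂ, ProbabilityTheory.complexMGF id ν z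
      = ∫ t in Ioi (0:ℝ), ((t ^ (-α) : ℝ) : ℂ) * Complex.exp (z * t) := by
    intro z
    rw [ProbabilityTheory.complexMGF, hν, integral_withDensity_eq_integral_toReal_smul hmeas
      (ae_of_all _ fun _ => ENNReal.ofReal_lt_top)]
    refine setIntegral_congr_fun measurableSet_Ioi fun t ht => ?_
    have : 0 ≤ t ^ (-α) := rpow_nonneg (le_of_lt ht) _
    simp [ENNReal.toReal_ofReal this]
  have hset : Iio 0 ⊆ ProbabilityTheory.integrableExpSet id ν := by
    intro s hs
    have h := Real.GammaIntegral_convergent (show 0 < 1 - α by linarith)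
    show Integrable _ ν
    rw [hν, integrable_withDensity_iff_integrable_smul' hmeas
      (ae_of_all _ fun _ => ENNReal.ofReal_lt_top)]
    have hh : IntegrableOn (fun t : ℝ => t ^ (-α) * rexp (s * t)) (Ioi 0) := by
      have := integrableOn_rpow_mul_exp_neg_mul_rpow (p := 1) (s := -α) (b := -s)
        (by linarith) (by norm_num) (by simpa using hs)
      simpa using this
    refine hh.congr_fun (fun t ht => ?_) measurableSet_Ioi
    have : 0 ≤ t ^ (-α) := rpow_nonneg (le_of_lt ht) _
    simp [ENNReal.toReal_ofReal this]
  have hsub : Iio 0 ⊆ interior (ProbabilityTheory.integrableExpSet id ν) :=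
    interior_maximal hset isOpen_Iio
  have hf : AnalyticOnNhd ℂ (ProbabilityTheory.complexMGF id ν) {z | z.re < 0} := fun z hz =>
    ProbabilityTheory.analyticAt_complexMGF (hsub hz)
  have hg : AnalyticOnNhd ℂ (fun z : ℂ => (Real.Gamma (1 - α) : ℂ) * (-z) ^ ((α : ℂ) - 1))
      {z | z.re < 0} := by
    intro z hz
    refine analyticAt_const.mul ?_
    refine AnalyticAt.cpow (by fun_prop) analyticAt_const ?_
    left; simpa using hz
  have hpre : IsPreconnected {z : ℂ | z.re < 0} := (convex_halfSpace_re_lt 0).isPreconnected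
  have hreal : ∀ s : ℝ, s < 0 → ProbabilityTheory.complexMGF id ν (s : ℂ)
      = (Real.Gamma (1 - α) : ℂ) * (-(s:ℂ)) ^ ((α : ℂ) - 1) := by
    intro s hs
    rw [hInt]
    have h := Real.integral_rpow_mul_exp_neg_mul_Ioi (a := 1 - α) (r := -s) (by linarith)
      (by linarith)
    have e : ∀ t : ℝ, ((t ^ (-α) : ℝ) : ℂ) * Complex.exp (s * t)
        = ((t ^ (1 - α - 1) * rexp (-(-s * t)) : ℝ) : ℂ) := by
      intro t
      push_cast
      congr 2
      · ring_nf
      · ring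
    simp_rw [e]
    rw [integral_complex_ofReal, h]
    have : (1 / -s) ^ (1 - α) = (-s) ^ (α - 1) := by
      rw [one_div, inv_rpow (by linarith), ← rpow_neg (by linarith)]; congr 1; ring
    rw [this]
    push_cast [Complex.ofReal_cpow (show 0 ≤ -s by linarith)]
    ring
  have key := hf.eqOn_of_preconnected_of_frequently_eq hg hpre
    (z₀ := (-1 : ℂ)) (by simp) ?_
  · have := key (show -r ∈ {z : ℂ | z.re < 0} by simpa using hr)
    rw [hInt] at this
    simpa using this
  · have ht : Tendsto (fun n : ℕ => ((-1 - 1 / ((n:ℝ) + 1) : ℝ) : ℂ)) atTop (𝓝[≠] (-1)) := by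
      refine tendsto_nhdsWithin_iff.2 ⟨?_, ?_⟩
      · have h1 := tendsto_one_div_add_atTop_nhds_zero_nat (𝕜 := ℝ)
        have h2 := (tendsto_const_nhds (x := (-1:ℝ))).sub h1
        have h3 := (Complex.continuous_ofReal.tendsto _).comp h2
        simpa [Function.comp_def] using h3
      · refine Eventually.of_forall fun n => ?_
        intro h
        have h' : (-1 - 1 / ((n:ℝ) + 1) : ℝ) = -1 := by
          apply Complex.ofReal_injective; rw [h]; simp
        have : 0 < 1 / ((n:ℝ) + 1) := by positivity
        linarith
    refine ht.frequently (Frequently.of_forall fun n => ?_)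
    have : 0 < 1 / ((n:ℝ) + 1) := by positivity
    exact hreal _ (by linarith)

lemma levy_aux_pos {α : ℝ} (hα0 : 0 < α) (hα1 : α < 1) {r : ℂ} (hr : 0 < r.re) :
    ∫ t in Ioi (0:ℝ), (Complex.exp (-(r * t)) - 1) * ((t ^ (-1 - α) : ℝ) : ℂ)
      = (Real.Gamma (-α) : ℂ) * r ^ (α : ℂ) := by
  have hr0 : r ≠ 0 := fun h => by simp [h] at hr
  have hαc : (α : ℂ) ≠ 0 := by exact_mod_cast hα0.ne'
  have hre : ∀ t : ℝ, 0 < t → (-(r * t)).re ≤ 0 := fun t ht => by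
    simp; positivity
  have hb : ∀ t : ℝ, 0 < t → ‖Complex.exp (-(r * t)) - 1‖ ≤ 2 * (1 + ‖r‖) * min 1 t := by
    intro t ht
    refine (norm_exp_sub_one_le_min (hre t ht)).trans ?_
    rw [norm_neg, norm_mul, Complex.norm_real, norm_of_nonneg ht.le, mul_assoc]
    gcongr
    rw [mul_min_of_nonneg _ _ (by positivity)]
    have := norm_nonneg r
    refine min_le_min (by linarith) (by nlinarith)
  have hi1 : IntegrableOn (fun t : ℝ => (Complex.exp (-(r * t)) - 1) * ((t ^ (-1 - α) : ℝ) : ℂ))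
      (Ioi 0) := by
    have h := (integrableOn_min_rpow hα0 hα1).const_mul (2 * (1 + ‖r‖))
    refine Integrable.mono' h (by fun_prop) ?_
    refine (ae_restrict_iff' measurableSet_Ioi).2 (ae_of_all _ fun t ht => ?_)
    have ht0 : 0 < t := ht
    rw [norm_mul, Complex.norm_real, norm_of_nonneg (by positivity), rpow_one, ← mul_assoc]
    gcongr
    exact hb t ht0
  have hi2 : IntegrableOn (fun t : ℝ => (-r * Complex.exp (-(r * t))) *
      ((t ^ (-α) / (-α) : ℝ) : ℂ)) (Ioi 0) := by
    have hh : IntegrableOn (fun t : ℝ => t ^ (-α) * rexp (-r.re * t)) (Ioi 0) := by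
      have := integrableOn_rpow_mul_exp_neg_mul_rpow (p := 1) (s := -α) (b := r.re)
        (by linarith) (by norm_num) hr
      simpa using this
    refine Integrable.mono' (hh.const_mul (‖r‖ / α)) (by fun_prop) ?_
    refine (ae_restrict_iff' measurableSet_Ioi).2 (ae_of_all _ fun t ht => ?_)
    have ht0 : 0 < t := ht
    rw [norm_mul, norm_mul, Complex.norm_exp, Complex.norm_real, norm_neg, norm_div, norm_neg,
      norm_of_nonneg hα0.le, norm_of_nonneg (rpow_nonneg ht0.le _)]
    apply le_of_eq
    simp
    ring
  have hibp := integral_Ioi_mul_deriv_eq_deriv_mul (a := (0:ℝ))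
    (u := fun t : ℝ => Complex.exp (-(r * t)) - 1) (u' := fun t : ℝ => -r * Complex.exp (-(r * t)))
    (v := fun t : ℝ => ((t ^ (-α) / (-α) : ℝ) : ℂ)) (v' := fun t : ℝ => ((t ^ (-1 - α) : ℝ) : ℂ))
    (a' := 0) (b' := 0) ?_ ?_ hi1 hi2 ?_ ?_
  · rw [hibp]
    have e : ∀ t : ℝ, -r * Complex.exp (-(r * t)) * ((t ^ (-α) / (-α) : ℝ) : ℂ)
        = (r / α) * (((t ^ (-α) : ℝ) : ℂ) * Complex.exp (-(r * t))) := by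
      intro t; push_cast; field_simp
    simp_rw [e]
    rw [integral_const_mul, laplace_gamma hα1 hr]
    have hG : Real.Gamma (1 - α) = -α * Real.Gamma (-α) := by
      rw [← Real.Gamma_add_one (by linarith)]; congr 1; ring
    rw [hG, Complex.cpow_sub _ _ hr0, Complex.cpow_one]
    push_cast
    field_simp
    ring
  · intro t ht
    have h1 : HasDerivAt (fun t : ℝ => (t : ℂ)) 1 t := Complex.ofRealCLM.hasDerivAt
    have h2 : HasDerivAt (fun t : ℝ => -(r * (t:ℂ))) (-r) t := by
      have := (h1.const_mul r).fun_neg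
      rw [mul_one] at this
      exact this
    have h3 := h2.cexp.sub_const 1
    convert! h3 using 1
    ring
  · intro t ht
    have ht0 : (0:ℝ) < t := ht
    have h1 := (Real.hasDerivAt_rpow_const (x := t) (p := -α) (Or.inl ht0.ne')).div_const (-α)
    have h2 := h1.ofReal_comp
    convert! h2 using 1
    rw [mul_div_assoc, mul_comm, div_mul_cancel₀ _ (by linarith)]
    ring_nf
  · have hz : Tendsto (fun t : ℝ => 2 * (1 + ‖r‖) / α * t ^ (1 - α)) (𝓝[>] 0) (𝓝 0) := by
      have : Tendsto (fun t : ℝ => t ^ (1 - α)) (𝓝[>] 0) (𝓝 0) := by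
        have h := (Real.continuousAt_rpow_const 0 (1 - α) (Or.inr (by linarith))).tendsto
        rw [zero_rpow (by linarith)] at h
        exact h.mono_left nhdsWithin_le_nhds
      simpa using this.const_mul (2 * (1 + ‖r‖) / α)
    refine squeeze_zero_norm' ?_ hz
    filter_upwards [self_mem_nhdsWithin] with t ht
    have ht0 : (0:ℝ) < t := ht
    rw [Pi.mul_apply, norm_mul, Complex.norm_real, norm_div, norm_neg,
      norm_of_nonneg hα0.le, norm_of_nonneg (rpow_nonneg ht0.le _)]
    calc _ ≤ (2 * (1 + ‖r‖) * t) * (t ^ (-α) / α) := by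
          gcongr
          refine (hb t ht0).trans ?_
          gcongr
          exact min_le_right _ _
      _ = _ := by
          rw [sub_eq_add_neg, rpow_add ht0, rpow_one]; ring
  · have hz : Tendsto (fun t : ℝ => 2 * (1 + ‖r‖) / α * t ^ (-α)) atTop (𝓝 0) := by
      simpa using (tendsto_rpow_neg_atTop hα0).const_mul (2 * (1 + ‖r‖) / α)
    refine squeeze_zero_norm' ?_ hz
    filter_upwards [eventually_gt_atTop 0] with t ht0
    rw [Pi.mul_apply, norm_mul, Complex.norm_real, norm_div, norm_neg,
      norm_of_nonneg hα0.le, norm_of_nonneg (rpow_nonneg ht0.le _)]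
    calc _ ≤ (2 * (1 + ‖r‖) * 1) * (t ^ (-α) / α) := by
          gcongr
          refine (hb t ht0).trans ?_
          gcongr
          exact min_le_left _ _
      _ = _ := by ring

/-- The one-sided Lévy integral. -/
lemma levy_one_sided {α : ℝ} (hα0 : 0 < α) (hα1 : α < 1) {l : ℝ} (hl : l ≠ 0) :
    ∫ t in Ioi (0:ℝ), (Complex.exp (Complex.I * l * t) - 1) * ((t ^ (-1 - α) : ℝ) : ℂ)
      = (Real.Gamma (-α) : ℂ) * (-(Complex.I * l)) ^ (α : ℂ) := by
  set s : ℕ → ℂ := fun n => ((1 / ((n:ℝ) + 1) : ℝ) : ℂ) - Complex.I * l with hs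
  have hlim : Tendsto s atTop (𝓝 (-(Complex.I * l))) := by
    have h1 := tendsto_one_div_add_atTop_nhds_zero_nat (𝕜 := ℝ)
    have h3 := ((Complex.continuous_ofReal.tendsto _).comp h1).sub_const (Complex.I * l)
    simpa [Function.comp_def, hs] using h3
  have hre : ∀ n, (s n).re = 1 / ((n:ℝ) + 1) := by
    intro n; simp only [hs, Complex.sub_re, Complex.ofReal_re]; simp
  have hpos : ∀ n, 0 < (s n).re := by
    intro n
    rw [hre]; positivity
  have hle : ∀ n, ‖s n‖ ≤ 1 + |l| := by
    intro n
    refine (norm_sub_le _ _).trans ?_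
    rw [norm_mul, Complex.norm_I, Complex.norm_real, Complex.norm_real, one_mul,
      norm_of_nonneg (by positivity), Real.norm_eq_abs]
    gcongr
    rw [div_le_one (by positivity)]
    have : (0:ℝ) ≤ n := by positivity
    linarith
  have hL : Tendsto (fun n => ∫ t in Ioi (0:ℝ), (Complex.exp (-(s n * t)) - 1) *
      ((t ^ (-1 - α) : ℝ) : ℂ)) atTop (𝓝 (∫ t in Ioi (0:ℝ),
        (Complex.exp (Complex.I * l * t) - 1) * ((t ^ (-1 - α) : ℝ) : ℂ))) := by
    refine tendsto_integral_of_dominated_convergence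
      (fun t : ℝ => 2 * (2 + |l|) * (min 1 (t ^ (1:ℝ)) * t ^ (-1 - α))) (fun n => by fun_prop)
      ((integrableOn_min_rpow hα0 hα1).const_mul _) (fun n => ?_) ?_
    · refine (ae_restrict_iff' measurableSet_Ioi).2 (ae_of_all _ fun t ht => ?_)
      have ht0 : 0 < t := ht
      rw [norm_mul, Complex.norm_real, norm_of_nonneg (rpow_nonneg ht0.le _), rpow_one, ← mul_assoc]
      gcongr
      have hre : (-(s n * t)).re ≤ 0 := by
        have := hpos n
        simp only [Complex.neg_re, Complex.re_mul_ofReal]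
        have := mul_pos this ht0
        linarith
      refine (norm_exp_sub_one_le_min hre).trans ?_
      rw [norm_neg, norm_mul, Complex.norm_real, norm_of_nonneg ht0.le, mul_assoc]
      gcongr
      rw [mul_min_of_nonneg _ _ (by positivity)]
      have := hle n
      have := abs_nonneg l
      refine min_le_min (by linarith) (by nlinarith)
    · refine ae_of_all _ fun t => ?_
      refine Tendsto.mul_const _ (Tendsto.sub_const ?_ _)
      refine (Complex.continuous_exp.tendsto _).comp ?_
      have := (hlim.mul_const (t:ℂ)).neg
      simpa using this
  have hR : Tendsto (fun n => (Real.Gamma (-α) : ℂ) * (s n) ^ (α : ℂ)) atTop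
      (𝓝 ((Real.Gamma (-α) : ℂ) * (-(Complex.I * l)) ^ (α : ℂ))) := by
    refine Tendsto.const_mul _ ?_
    have hc : ContinuousAt (fun z : ℂ => z ^ (α : ℂ)) (-(Complex.I * l)) := by
      refine continuousAt_cpow_const ?_
      right; simpa using hl
    exact hc.tendsto.comp hlim
  simp_rw [levy_aux_pos hα0 hα1 (hpos _)] at hL
  exact tendsto_nhds_unique hL hR

lemma neg_I_cpow (α : ℝ) {l : ℝ} (hl : 0 < l) :
    (-(Complex.I * l)) ^ (α : ℂ) =
      ((l ^ α : ℝ) : ℂ) * (Real.cos (π * α / 2) - Complex.I * Real.sin (π * α / 2)) := by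
  have h : -(Complex.I * l) = (l : ℂ) * (-Complex.I) := by ring
  have hl0 : (l : ℂ) ≠ 0 := by exact_mod_cast hl.ne'
  rw [h, Complex.cpow_def_of_ne_zero (by simp [hl0]), Complex.log_ofReal_mul hl (by simp), add_mul,
    Complex.exp_add, Complex.ofReal_log hl.le, ← Complex.cpow_def_of_ne_zero hl0,
    ← Complex.ofReal_cpow hl.le]
  congr 1
  rw [Complex.log_neg_I]
  rw [show (-(↑π / 2) * Complex.I) * (α : ℂ) = ((-(π * α / 2) : ℝ) : ℂ) * Complex.I by
    push_cast; ring]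
  rw [Complex.exp_mul_I]
  push_cast
  simp only [Complex.cos_neg, Complex.sin_neg]
  ring

lemma I_cpow (α : ℝ) {l : ℝ} (hl : 0 < l) :
    (Complex.I * l) ^ (α : ℂ) =
      ((l ^ α : ℝ) : ℂ) * (Real.cos (π * α / 2) + Complex.I * Real.sin (π * α / 2)) := by
  have h : Complex.I * l = (l : ℂ) * Complex.I := by ring
  have hl0 : (l : ℂ) ≠ 0 := by exact_mod_cast hl.ne'
  rw [h, Complex.cpow_def_of_ne_zero (by simp [hl0]), Complex.log_ofReal_mul hl (by simp), add_mul,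
    Complex.exp_add, Complex.ofReal_log hl.le, ← Complex.cpow_def_of_ne_zero hl0,
    ← Complex.ofReal_cpow hl.le]
  congr 1
  rw [Complex.log_I]
  rw [show (↑π / 2 * Complex.I) * (α : ℂ) = (((π * α / 2) : ℝ) : ℂ) * Complex.I by
    push_cast; ring]
  rw [Complex.exp_mul_I]
  push_cast
  ring

/-- One-sided Lévy integral with explicit value. -/
lemma levy_one_sided' {α : ℝ} (hα0 : 0 < α) (hα1 : α < 1) (l : ℝ) :
    ∫ t in Ioi (0:ℝ), (Complex.exp (Complex.I * l * t) - 1) * ((t ^ (-1 - α) : ℝ) : ℂ)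
      = (Real.Gamma (-α) : ℂ) * (((|l| ^ α : ℝ) : ℂ) *
        (Real.cos (π * α / 2) - Complex.I * Real.sign l * Real.sin (π * α / 2))) := by
  rcases lt_trichotomy l 0 with hl | hl | hl
  · rw [levy_one_sided hα0 hα1 hl.ne, Real.sign_of_neg hl, abs_of_neg hl,
      show -(Complex.I * l) = Complex.I * ((-l : ℝ) : ℂ) by push_cast; ring,
      I_cpow α (show 0 < -l by linarith)]
    push_cast
    ring
  · subst hl
    simp [zero_rpow hα0.ne']
  · rw [levy_one_sided hα0 hα1 hl.ne', Real.sign_of_pos hl, abs_of_pos hl, neg_I_cpow α hl]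
    push_cast
    ring

lemma abs_cos_sub_one_le (l t : ℝ) : |Real.cos (l * t) - 1| ≤ (2 + l ^ 2) * min 1 (|t| ^ (2:ℝ)) := by
  have h1 := Real.one_sub_sq_div_two_le_cos (x := l * t)
  have h2 := Real.cos_le_one (l * t)
  have h3 := Real.neg_one_le_cos (l * t)
  rw [abs_of_nonpos (by linarith), show (2:ℝ) = ((2:ℕ):ℝ) by norm_num, rpow_natCast, sq_abs,
    mul_min_of_nonneg _ _ (by positivity)]
  push_cast
  refine le_min (by nlinarith [sq_nonneg l]) (by nlinarith [sq_nonneg (l * t), sq_nonneg t])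

lemma cos_levy {α : ℝ} (hα0 : 0 < α) (hα1 : α < 1) (l : ℝ) :
    ∫ t in Ioi (0:ℝ), (Real.cos (l * t) - 1) * t ^ (-1 - α)
      = Real.Gamma (-α) * (|l| ^ α * Real.cos (π * α / 2)) := by
  have hi1 : IntegrableOn (fun t : ℝ => (Complex.exp (Complex.I * l * t) - 1) *
      ((t ^ (-1 - α) : ℝ) : ℂ)) (Ioi 0) := by
    have h := (integrableOn_min_rpow hα0 hα1).const_mul (2 * (1 + |l|))
    refine Integrable.mono' h (by fun_prop) ?_
    refine (ae_restrict_iff' measurableSet_Ioi).2 (ae_of_all _ fun t ht => ?_)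
    have ht0 : 0 < t := ht
    rw [norm_mul, Complex.norm_real, norm_of_nonneg (rpow_nonneg ht0.le _), rpow_one, ← mul_assoc]
    gcongr
    refine (norm_exp_sub_one_le_min (by simp)).trans ?_
    rw [norm_mul, norm_mul, Complex.norm_I, Complex.norm_real, Complex.norm_real,
      norm_of_nonneg ht0.le, one_mul, Real.norm_eq_abs, mul_assoc 2 (1 + |l|)]
    refine mul_le_mul_of_nonneg_left ?_ (by norm_num)
    rw [mul_min_of_nonneg _ _ (by positivity)]
    have := abs_nonneg l
    refine min_le_min (by linarith) (by nlinarith)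
  have h := congrArg Complex.re (levy_one_sided' hα0 hα1 l)
  have h2 := Complex.reCLM.integral_comp_comm hi1
  simp only [Complex.reCLM_apply] at h2
  rw [← h2] at h
  have e : ∀ t : ℝ, ((Complex.exp (Complex.I * l * t) - 1) * ((t ^ (-1 - α) : ℝ) : ℂ)).re
      = (Real.cos (l * t) - 1) * t ^ (-1 - α) := by
    intro t
    rw [Complex.re_mul_ofReal, Complex.sub_re, show Complex.I * l * t = ((l * t : ℝ) : ℂ) * Complex.I
      by push_cast; ring, Complex.exp_ofReal_mul_I_re, Complex.one_re]
  simp_rw [e] at h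
  rw [h, Complex.re_ofReal_mul, Complex.re_ofReal_mul, Complex.sub_re, Complex.ofReal_re,
    mul_assoc Complex.I, ← Complex.ofReal_mul, Complex.I_mul_re, Complex.ofReal_im, neg_zero,
    sub_zero]

lemma cos_levy_one (l : ℝ) :
    ∫ t in Ioi (0:ℝ), (Real.cos (l * t) - 1) * t ^ (-1 - 1 : ℝ) = - (π / 2 * |l|) := by
  set h : ℕ → ℝ := fun n => 1 / ((n:ℝ) + 2) with hh
  have hpos : ∀ n, 0 < h n := fun n => by simp only [hh]; positivity
  have hle : ∀ n, h n ≤ 1 / 2 := fun n => by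
    simp only [hh]
    gcongr
    have : (0:ℝ) ≤ n := by positivity
    linarith
  have hlim : Tendsto h atTop (𝓝 0) := by
    have := (tendsto_add_atTop_iff_nat 1).2 (tendsto_one_div_add_atTop_nhds_zero_nat (𝕜 := ℝ))
    refine this.congr fun n => ?_
    simp only [hh]; push_cast; ring_nf
  have hL : Tendsto (fun n => ∫ t in Ioi (0:ℝ), (Real.cos (l * t) - 1) * t ^ (-1 - (1 - h n)))
      atTop (𝓝 (∫ t in Ioi (0:ℝ), (Real.cos (l * t) - 1) * t ^ (-1 - 1 : ℝ))) := by
    refine tendsto_integral_of_dominated_convergence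
      (fun t : ℝ => (2 + l ^ 2) * ((min 1 (t ^ (2:ℝ)) * t ^ (-1 - (1/2) : ℝ)) +
        (min 1 (t ^ (2:ℝ)) * t ^ (-1 - 1 : ℝ)))) (fun n => ?_) ?_ (fun n => ?_) ?_
    · exact Measurable.aestronglyMeasurable (by fun_prop)
    · exact ((integrableOn_min_rpow (by norm_num) (by norm_num)).add
        (integrableOn_min_rpow (by norm_num) (by norm_num))).const_mul _
    · refine (ae_restrict_iff' measurableSet_Ioi).2 (ae_of_all _ fun t ht => ?_)
      have ht0 : 0 < t := ht
      rw [norm_mul, Real.norm_eq_abs, norm_of_nonneg (rpow_nonneg ht0.le _), ← mul_add, ← mul_assoc]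
      have hb := abs_cos_sub_one_le l t
      rw [abs_of_pos ht0] at hb
      gcongr
      have p1 : 0 ≤ t ^ (-1 - (1/2) : ℝ) := rpow_nonneg ht0.le _
      have p2 : 0 ≤ t ^ (-1 - 1 : ℝ) := rpow_nonneg ht0.le _
      rcases le_total t 1 with h1 | h1
      · have : t ^ (-1 - (1 - h n)) ≤ t ^ (-1 - 1 : ℝ) :=
          rpow_le_rpow_of_exponent_ge ht0 h1 (by linarith [hpos n])
        exact this.trans (le_add_of_nonneg_left p1)
      · have : t ^ (-1 - (1 - h n)) ≤ t ^ (-1 - (1/2) : ℝ) :=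
          rpow_le_rpow_of_exponent_le h1 (by linarith [hle n])
        exact this.trans (le_add_of_nonneg_right p2)
    · refine (ae_restrict_iff' measurableSet_Ioi).2 (ae_of_all _ fun t ht => ?_)
      have ht0 : (0:ℝ) < t := ht
      refine Tendsto.const_mul _ ?_
      refine Tendsto.rpow tendsto_const_nhds ?_ (Or.inl ht0.ne')
      simpa using ((tendsto_const_nhds (x := (1:ℝ))).sub hlim).const_sub (-1)
  have e : ∀ n, ∫ t in Ioi (0:ℝ), (Real.cos (l * t) - 1) * t ^ (-1 - (1 - h n))
      = - (Real.Gamma (1 + h n) / (1 - h n) * (|l| ^ (1 - h n) *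
        (π / 2 * Real.sinc (π / 2 * h n)))) := by
    intro n
    have p := hpos n
    have q := hle n
    rw [cos_levy (by linarith) (by linarith)]
    have g1 : Real.Gamma (1 + h n) = h n * ((h n - 1) * Real.Gamma (-(1 - h n))) := by
      have g0 := Real.Gamma_add_one (s := -(1 - h n)) (by linarith)
      rw [show -(1 - h n) + 1 = h n by ring] at g0
      rw [add_comm, Real.Gamma_add_one p.ne', g0]
      ring
    have g2 : Real.cos (π * (1 - h n) / 2) = Real.sin (π / 2 * h n) := by
      rw [← Real.cos_pi_div_two_sub]; congr 1; ring
    have hx : π / 2 * h n ≠ 0 := by positivity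
    rw [g2, g1, Real.sinc_of_ne_zero hx]
    have : 1 - h n ≠ 0 := by linarith
    field_simp
    ring
  have hR : Tendsto (fun n => - (Real.Gamma (1 + h n) / (1 - h n) * (|l| ^ (1 - h n) *
        (π / 2 * Real.sinc (π / 2 * h n))))) atTop (𝓝 (-(Real.Gamma (1 + 0) / (1 - 0) *
          (|l| ^ (1 - 0 : ℝ) * (π / 2 * Real.sinc (π / 2 * 0)))))) := by
    have c1 : Tendsto (fun n => Real.Gamma (1 + h n)) atTop (𝓝 (Real.Gamma (1 + 0))) := by
      have : ContinuousAt Real.Gamma (1 + 0) := by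
        refine (Real.differentiableAt_Gamma fun m => ?_).continuousAt
        have : (0:ℝ) ≤ m := by positivity
        linarith
      exact this.tendsto.comp (hlim.const_add 1)
    refine (Tendsto.mul (c1.div (hlim.const_sub 1) (by norm_num)) (Tendsto.mul ?_ ?_)).neg
    · exact Tendsto.rpow tendsto_const_nhds (hlim.const_sub 1) (Or.inr (by norm_num))
    · exact ((Real.continuous_sinc.tendsto _).comp (hlim.const_mul (π/2))).const_mul _
  simp_rw [e] at hL
  have := tendsto_nhds_unique hL hR
  rw [this]
  simp
  ring

/-- compensator -/
def cU (α u : ℝ) : ℝ := if α = 1 then (if |u| ≤ 1 then u else 0) else 0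

/-- The Lévy symbol. -/
def Psi (α δ l : ℝ) : ℂ := ((-(|l| ^ α) : ℝ) : ℂ) *
    (1 - Complex.I * (δ : ℂ) * ((Real.sign l : ℝ) : ℂ) * ((Real.tan (π * α / 2) : ℝ) : ℂ))

/-- The kernel. -/
def Ker (α l u : ℝ) : ℂ := Complex.exp (Complex.I * l * u) - 1 - Complex.I * l * cU α u

lemma measurable_cU (α : ℝ) : Measurable (cU α) := by
  unfold cU
  by_cases h : α = 1
  · simp only [h, if_true]
    refine Measurable.ite ?_ measurable_id measurable_const
    exact measurableSet_le (by fun_prop) measurable_const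
  · simp only [h, if_false]; exact measurable_const

lemma measurable_nuDens (α δ : ℝ) : Measurable (nuDens α δ) := by
  unfold nuDens
  refine Measurable.const_mul ?_ _
  refine Measurable.ite measurableSet_Ioi (by fun_prop) ?_
  exact Measurable.ite measurableSet_Iio (by fun_prop) measurable_const

lemma measurable_Ker (α : ℝ) : Measurable (fun p : ℝ × ℝ => Ker α p.1 p.2) := by
  unfold Ker
  have := measurable_cU α
  fun_prop

lemma abs_nuDens_le {α δ : ℝ} (hδ : δ ∈ Set.Ioo (-1 : ℝ) 1) (u : ℝ) :
    |nuDens α δ u| ≤ |dconst α| * |u| ^ (-1 - α) := by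
  have h1 := hδ.1
  have h2 := hδ.2
  unfold nuDens
  rw [abs_mul]
  gcongr
  have hp : 0 ≤ |u| ^ (-1 - α) := rpow_nonneg (abs_nonneg _) _
  split_ifs with h h'
  · rw [abs_of_pos h] at hp ⊢
    rw [abs_of_nonneg (by apply mul_nonneg; linarith; exact hp)]
    nlinarith
  · rw [abs_of_nonneg (by apply mul_nonneg; linarith; exact hp)]
    nlinarith
  · simpa using hp

lemma norm_I_mul (l u : ℝ) : ‖Complex.I * l * u‖ = |l| * |u| := by
  rw [norm_mul, norm_mul, Complex.norm_I, Complex.norm_real, Complex.norm_real, one_mul]; rfl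

lemma kernel_bound {α δ : ℝ} (hα0 : 0 < α) (hα1 : α ≤ 1) (hδ : δ ∈ Set.Ioo (-1 : ℝ) 1) :
    ∃ m : ℝ → ℝ, Integrable m ∧ (∀ u, 0 ≤ m u) ∧
      ∀ l u : ℝ, ‖Ker α l u * (nuDens α δ u : ℂ)‖ ≤ (1 + l ^ 2) * m u := by
  rcases eq_or_lt_of_le hα1 with h1 | h1
  · subst h1
    refine ⟨fun u => (3 * |dconst 1|) * (min 1 (|u| ^ (2:ℝ)) * |u| ^ (-1 - 1 : ℝ)),
      (integrable_min_abs (by norm_num) (by norm_num)).const_mul _, fun u => by positivity, ?_⟩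
    intro l u
    rw [norm_mul, Complex.norm_real, Real.norm_eq_abs]
    have hk : ‖Ker 1 l u‖ ≤ 3 * (1 + l ^ 2) * min 1 (|u| ^ (2:ℝ)) := by
      unfold Ker cU
      rw [if_pos rfl, show (2:ℝ) = ((2:ℕ):ℝ) by norm_num, rpow_natCast]
      split_ifs with hu
      · have := norm_exp_sub_one_sub_le (z := Complex.I * l * u) (by simp)
        refine this.trans ?_
        rw [norm_I_mul, min_eq_right (by nlinarith [abs_nonneg u]), mul_pow, sq_abs]
        nlinarith [sq_nonneg |u|]
      · have := norm_exp_sub_one_le_min (z := Complex.I * l * u) (by simp)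
        rw [not_le] at hu
        rw [min_eq_left (by nlinarith [abs_nonneg u])]
        have h2 : min 1 ‖Complex.I * (l:ℂ) * u‖ ≤ 1 := min_le_left _ _
        simp only [Complex.ofReal_zero, mul_zero, sub_zero]
        nlinarith [sq_nonneg l]
    calc _ ≤ (3 * (1 + l ^ 2) * min 1 (|u| ^ (2:ℝ))) * (|dconst 1| * |u| ^ (-1 - 1 : ℝ)) := by
          gcongr
          exact abs_nuDens_le hδ u
      _ = _ := by ring
  · refine ⟨fun u => (4 * |dconst α|) * (min 1 (|u| ^ (1:ℝ)) * |u| ^ (-1 - α : ℝ)),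
      (integrable_min_abs hα0 h1).const_mul _, fun u => by positivity, ?_⟩
    intro l u
    rw [norm_mul, Complex.norm_real, Real.norm_eq_abs]
    have hk : ‖Ker α l u‖ ≤ 4 * (1 + l ^ 2) * min 1 (|u| ^ (1:ℝ)) := by
      unfold Ker cU
      rw [if_neg h1.ne, rpow_one]
      have := norm_exp_sub_one_le_min (z := Complex.I * l * u) (by simp)
      simp only [Complex.ofReal_zero, mul_zero, sub_zero]
      refine this.trans ?_
      rw [norm_I_mul, show 4 * (1 + l ^ 2) * min 1 |u| = 2 * ((2 * (1 + l ^ 2)) * min 1 |u|) by ring]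
      refine mul_le_mul_of_nonneg_left ?_ (by norm_num)
      rw [mul_min_of_nonneg _ _ (by positivity)]
      have h3 : |l| ≤ 2 * (1 + l ^ 2) := by
        nlinarith [sq_nonneg (|l| - 1), sq_abs l]
      refine min_le_min (by nlinarith [sq_nonneg l]) (by gcongr)
    calc _ ≤ (4 * (1 + l ^ 2) * min 1 (|u| ^ (1:ℝ))) * (|dconst α| * |u| ^ (-1 - α : ℝ)) := by
          gcongr
          exact abs_nuDens_le hδ u
      _ = _ := by ring

lemma integrable_kernel {α δ : ℝ} (hα0 : 0 < α) (hα1 : α ≤ 1) (hδ : δ ∈ Set.Ioo (-1 : ℝ) 1)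
    (l : ℝ) : Integrable (fun u => Ker α l u * (nuDens α δ u : ℂ)) := by
  obtain ⟨m, hm, -, hb⟩ := kernel_bound hα0 hα1 hδ
  have h1 : Measurable (fun u => Ker α l u) := by
    unfold Ker
    have := measurable_cU α
    fun_prop
  have h2 := measurable_nuDens α δ
  have h3 : AEStronglyMeasurable (fun u => Ker α l u * (nuDens α δ u : ℂ)) volume :=
    (h1.mul (Complex.measurable_ofReal.comp h2)).aestronglyMeasurable
  exact Integrable.mono' (hm.const_mul (1 + l ^ 2)) h3 (ae_of_all _ fun u => hb l u)

lemma integral_split {g : ℝ → ℂ} (hg : Integrable g) :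
    ∫ u, g u = (∫ t in Ioi (0:ℝ), g t) + ∫ t in Ioi (0:ℝ), g (-t) := by
  rw [integral_comp_neg_Ioi, neg_zero, add_comm]
  exact (intervalIntegral.integral_Iic_add_Ioi hg.integrableOn hg.integrableOn).symm

lemma kernel_integral {α δ : ℝ} (hα0 : 0 < α) (hα1 : α ≤ 1) (hδ : δ ∈ Set.Ioo (-1 : ℝ) 1)
    (h1 : α = 1 → δ = 0) (l : ℝ) :
    ∫ u, Ker α l u * (nuDens α δ u : ℂ) = Psi α δ l := by
  have hInt := integrable_kernel hα0 hα1 hδ l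
  rw [integral_split hInt]
  rcases eq_or_lt_of_le hα1 with h | h
  · have hδ0 := h1 h
    subst h hδ0
    have hInt2 : Integrable (fun u => Ker 1 l (-u) * (nuDens 1 0 (-u) : ℂ)) := hInt.comp_neg
    rw [← integral_add hInt.integrableOn hInt2.integrableOn]
    have e : ∀ t ∈ Ioi (0:ℝ), Ker 1 l t * (nuDens 1 0 t : ℂ) + Ker 1 l (-t) * (nuDens 1 0 (-t) : ℂ)
        = ((2 / π * ((Real.cos (l * t) - 1) * t ^ (-1 - 1 : ℝ)) : ℝ) : ℂ) := by
      intro t ht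
      have ht0 : (0:ℝ) < t := ht
      have n1 : nuDens 1 0 t = 1 / π * t ^ (-1 - 1 : ℝ) := by
        unfold nuDens dconst; rw [if_pos rfl, if_pos ht0]; ring
      have n2 : nuDens 1 0 (-t) = 1 / π * t ^ (-1 - 1 : ℝ) := by
        unfold nuDens dconst
        rw [if_pos rfl, if_neg (by linarith), if_pos (by linarith), abs_neg, abs_of_pos ht0]; ring
      have n3 : cU 1 (-t) = - cU 1 t := by
        unfold cU; rw [if_pos rfl, if_pos rfl, abs_neg]; split_ifs <;> simp
      have n4 : Ker 1 l t + Ker 1 l (-t) = ((2 * (Real.cos (l * t) - 1) : ℝ) : ℂ) := by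
        unfold Ker
        rw [n3]
        have := Complex.two_cos (l * t : ℂ)
        push_cast
        rw [mul_sub, this]
        ring_nf
      rw [n1, n2, ← add_mul, n4]
      push_cast
      ring
    rw [setIntegral_congr_fun measurableSet_Ioi e, integral_complex_ofReal, integral_const_mul,
      cos_levy_one]
    unfold Psi
    have : (2 / π * -(π / 2 * |l|)) = - |l| := by field_simp
    rw [this]
    simp
  · have e1 : ∀ t ∈ Ioi (0:ℝ), Ker α l t * (nuDens α δ t : ℂ)
        = ((dconst α * ((1 + δ) / 2) : ℝ) : ℂ) *
          ((Complex.exp (Complex.I * l * t) - 1) * ((t ^ (-1 - α) : ℝ) : ℂ)) := by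
      intro t ht
      have ht0 : (0:ℝ) < t := ht
      unfold Ker nuDens cU
      rw [if_neg h.ne, if_pos ht0]
      push_cast
      ring
    have e2 : ∀ t ∈ Ioi (0:ℝ), Ker α l (-t) * (nuDens α δ (-t) : ℂ)
        = ((dconst α * ((1 - δ) / 2) : ℝ) : ℂ) *
          ((Complex.exp (Complex.I * ((-l : ℝ) : ℂ) * t) - 1) * ((t ^ (-1 - α) : ℝ) : ℂ)) := by
      intro t ht
      have ht0 : (0:ℝ) < t := ht
      unfold Ker nuDens cU
      rw [if_neg h.ne, if_neg (by linarith), if_pos (by linarith), abs_neg, abs_of_pos ht0]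
      push_cast
      ring_nf
    rw [setIntegral_congr_fun measurableSet_Ioi e1, setIntegral_congr_fun measurableSet_Ioi e2,
      integral_const_mul, integral_const_mul, levy_one_sided' hα0 h, levy_one_sided' hα0 h,
      abs_neg, Real.sign_neg]
    have hcos : Real.cos (π * α / 2) ≠ 0 := by
      refine (Real.cos_pos_of_mem_Ioo ⟨?_, ?_⟩).ne' <;> nlinarith [Real.pi_pos]
    have hG : Real.Gamma (-α) ≠ 0 := by
      have := Real.Gamma_add_one (s := -α) (by linarith)
      intro h0
      rw [h0, mul_zero] at this
      exact (Real.Gamma_pos_of_pos (show 0 < -α + 1 by linarith)).ne' this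
    have hd : dconst α = -1 / (Real.Gamma (-α) * Real.cos (π * α / 2)) := by
      unfold dconst; rw [if_neg h.ne]
    unfold Psi
    rw [hd, Real.tan_eq_sin_div_cos]
    have hcosc : (Real.cos (π * α / 2) : ℂ) ≠ 0 := by exact_mod_cast hcos
    have hGc : (Real.Gamma (-α) : ℂ) ≠ 0 := by exact_mod_cast hG
    generalize Real.cos (π * α / 2) = c at *
    generalize Real.Gamma (-α) = G at *
    generalize Real.sin (π * α / 2) = s at *
    push_cast
    field_simp
    ring


open scoped FourierTransform SchwartzMap LineDeriv

/-- The oscillating factor. -/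
def ee (ξ x : ℝ) : ℂ := Complex.exp (Complex.I * ((2 * π * ξ : ℝ) : ℂ) * (x : ℂ))

lemma norm_ee (ξ x : ℝ) : ‖ee ξ x‖ = 1 := by
  unfold ee
  rw [Complex.norm_exp]
  simp

lemma continuous_ee : Continuous (fun p : ℝ × ℝ => ee p.1 p.2) := by
  unfold ee
  fun_prop

lemma ee_add (ξ x u : ℝ) : ee ξ (x + u) = ee ξ x * Complex.exp (Complex.I * ((2 * π * ξ : ℝ) : ℂ) * (u : ℂ)) := by
  unfold ee
  rw [← Complex.exp_add]
  push_cast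
  ring_nf

lemma inv_apply (F : 𝓢(ℝ, ℂ)) (x : ℝ) : (𝓕⁻ F) x = ∫ ξ, ee ξ x * F ξ := by
  rw [SchwartzMap.fourierInv_coe, Real.fourierInv_eq']
  congr 1
  ext ξ
  unfold ee
  simp only [smul_eq_mul, RCLike.inner_apply, conj_trivial]
  congr 2
  push_cast
  ring

lemma integrable_ee {F : ℝ → ℂ} (hF : Integrable F) (x : ℝ) : Integrable (fun ξ => ee ξ x * F ξ) := by
  refine hF.bdd_mul (c := 1) ?_ ?_
  · exact (continuous_ee.comp (by fun_prop : Continuous fun ξ : ℝ => (ξ, x))).aestronglyMeasurable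
  · exact ae_of_all _ fun ξ => (norm_ee ξ x).le

/-- multiplication by the variable -/
def xmul (F : 𝓢(ℝ, ℂ)) : 𝓢(ℝ, ℂ) := SchwartzMap.smulLeftCLM ℂ (inner ℝ · (1:ℝ)) F

lemma xmul_apply (F : 𝓢(ℝ, ℂ)) (ξ : ℝ) : xmul F ξ = ξ * F ξ := by
  have : (fun x : ℝ => inner ℝ x (1:ℝ)).HasTemperateGrowth := by fun_prop
  unfold xmul
  rw [SchwartzMap.smulLeftCLM_apply_apply this]
  simp

lemma deriv_xmul (F : 𝓢(ℝ, ℂ)) (ξ : ℝ) : deriv (xmul F) ξ = F ξ + ξ * deriv F ξ := by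
  have : (xmul F : ℝ → ℂ) = fun ξ : ℝ => (ξ:ℂ) * F ξ := by ext; exact xmul_apply _ _
  rw [this]
  have h1 : HasDerivAt (fun ξ : ℝ => (ξ:ℂ)) 1 ξ := Complex.ofRealCLM.hasDerivAt
  have := (h1.mul (F.differentiableAt.hasDerivAt (x := ξ))).deriv
  rw [show (fun ξ : ℝ => (ξ:ℂ) * F ξ) = (fun ξ : ℝ => (ξ:ℂ)) * F from rfl, this]
  ring

lemma line_one (F : 𝓢(ℝ, ℂ)) (x : ℝ) : (∂_{(1:ℝ)} F) x = deriv F x := by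
  rw [SchwartzMap.lineDerivOp_apply_eq_fderiv]
  simp

lemma deriv_inv (F : 𝓢(ℝ, ℂ)) (x : ℝ) :
    deriv (𝓕⁻ F : 𝓢(ℝ, ℂ)) x = (2 * π * Complex.I) * (𝓕⁻ (xmul F)) x := by
  rw [← line_one, SchwartzMap.lineDerivOp_fourierInv_eq, FourierTransform.fourierInv_smul]
  rfl

lemma deriv_inv' (F : 𝓢(ℝ, ℂ)) (x : ℝ) :
    deriv (𝓕⁻ F : 𝓢(ℝ, ℂ)) x = ∫ ξ, ee ξ x * (Complex.I * ((2 * π * ξ : ℝ) : ℂ) * F ξ) := by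
  rw [deriv_inv, inv_apply, ← integral_const_mul]
  congr 1
  ext ξ
  rw [xmul_apply]
  push_cast
  ring

lemma x_deriv_inv (F : 𝓢(ℝ, ℂ)) (x : ℝ) :
    x * deriv (𝓕⁻ F : 𝓢(ℝ, ℂ)) x = - ∫ ξ, ee ξ x * (F ξ + ξ * deriv F ξ) := by
  have h := congrArg (fun g : 𝓢(ℝ, ℂ) => g x) (SchwartzMap.fourierInv_lineDerivOp_eq (xmul F) (1:ℝ))
  have e : SchwartzMap.smulLeftCLM ℂ (inner ℝ · (1:ℝ)) (𝓕⁻ (xmul F)) = xmul (𝓕⁻ (xmul F)) := rfl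
  rw [e] at h
  simp only [smul_apply, xmul_apply, inv_apply, smul_eq_mul, line_one, deriv_xmul] at h
  rw [h, deriv_inv, inv_apply]
  simp only [xmul_apply]
  ring

lemma integrable_wt (F : 𝓢(ℝ, ℂ)) : Integrable (fun ξ => (1 + (2 * π * ξ) ^ 2) * ‖F ξ‖) := by
  have h0 := (F.integrable (μ := volume)).norm
  have h2 := (F.integrable_pow_mul volume 2).const_mul ((2 * π) ^ 2)
  refine (h0.add h2).congr (ae_of_all _ fun ξ => ?_)
  simp only [Pi.add_apply, Real.norm_eq_abs, sq_abs]
  ring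

lemma incr_eq (α : ℝ) (F : 𝓢(ℝ, ℂ)) (x u : ℝ) :
    (𝓕⁻ F) (x + u) - (𝓕⁻ F) x - cU α u * deriv (𝓕⁻ F : 𝓢(ℝ, ℂ)) x
      = ∫ ξ, ee ξ x * (F ξ * Ker α (2 * π * ξ) u) := by
  rw [deriv_inv', inv_apply, inv_apply, ← integral_const_mul]
  have hi := F.integrable (μ := volume)
  have hi' : Integrable (fun ξ => Complex.I * ((2 * π * ξ : ℝ) : ℂ) * F ξ) := by
    refine ((xmul F).integrable (μ := volume)).const_mul (2 * π * Complex.I) |>.congr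
      (ae_of_all _ fun ξ => ?_)
    simp only [xmul_apply]
    push_cast
    ring
  rw [← integral_sub (integrable_ee hi _) (integrable_ee hi _), ← integral_sub]
  · congr 1
    ext ξ
    rw [ee_add]
    unfold Ker
    ring
  · exact (integrable_ee hi _).sub (integrable_ee hi _)
  · exact (integrable_ee hi' _).const_mul _

lemma integrable_prod_L {α δ : ℝ} (hα0 : 0 < α) (hα1 : α ≤ 1) (hδ : δ ∈ Set.Ioo (-1 : ℝ) 1)
    (F : 𝓢(ℝ, ℂ)) (x : ℝ) :
    Integrable (fun p : ℝ × ℝ => ee p.2 x * (F p.2 * Ker α (2 * π * p.2) p.1) * (nuDens α δ p.1 : ℂ))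
      (volume.prod volume) := by
  obtain ⟨m, hm, hm0, hb⟩ := kernel_bound hα0 hα1 hδ
  refine Integrable.mono' (hm.mul_prod (integrable_wt F)) ?_ (ae_of_all _ fun p => ?_)
  · have h1 : Measurable (fun p : ℝ × ℝ => Ker α (2 * π * p.2) p.1) := by
      unfold Ker
      have := measurable_cU α
      fun_prop
    have h2 : Measurable (fun p : ℝ × ℝ => (nuDens α δ p.1 : ℂ)) :=
      Complex.measurable_ofReal.comp ((measurable_nuDens α δ).comp measurable_fst)
    have h3 : Measurable (fun p : ℝ × ℝ => ee p.2 x) :=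
      (continuous_ee.comp (by fun_prop : Continuous fun p : ℝ × ℝ => (p.2, x))).measurable
    have h4 : Measurable (fun p : ℝ × ℝ => F p.2) := F.continuous.measurable.comp measurable_snd
    exact ((h3.mul (h4.mul h1)).mul h2).aestronglyMeasurable
  · have := hb (2 * π * p.2) p.1
    rw [norm_mul] at this
    rw [norm_mul, norm_mul, norm_mul, norm_ee, one_mul, mul_assoc]
    calc _ ≤ ‖F p.2‖ * ((1 + (2 * π * p.2) ^ 2) * m p.1) := by gcongr
      _ = _ := by ring

lemma L_inv {α δ : ℝ} (hα0 : 0 < α) (hα1 : α ≤ 1) (hδ : δ ∈ Set.Ioo (-1 : ℝ) 1)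
    (h1 : α = 1 → δ = 0) (F : 𝓢(ℝ, ℂ)) (x : ℝ) :
    Integrable (fun u => ((𝓕⁻ F) (x + u) - (𝓕⁻ F) x - cU α u * deriv (𝓕⁻ F : 𝓢(ℝ, ℂ)) x) * (nuDens α δ u : ℂ))
    ∧ ∫ u, ((𝓕⁻ F) (x + u) - (𝓕⁻ F) x - cU α u * deriv (𝓕⁻ F : 𝓢(ℝ, ℂ)) x) * (nuDens α δ u : ℂ)
      = ∫ ξ, ee ξ x * (F ξ * Psi α δ (2 * π * ξ)) := by
  have hp := integrable_prod_L hα0 hα1 hδ F x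
  have e : ∀ u, ((𝓕⁻ F) (x + u) - (𝓕⁻ F) x - cU α u * deriv (𝓕⁻ F : 𝓢(ℝ, ℂ)) x) * (nuDens α δ u : ℂ)
      = ∫ ξ, ee ξ x * (F ξ * Ker α (2 * π * ξ) u) * (nuDens α δ u : ℂ) := by
    intro u
    rw [incr_eq, integral_mul_const]
  constructor
  · simp only [e]
    exact hp.integral_prod_left
  · simp only [e]
    rw [integral_integral_swap hp]
    congr 1
    ext ξ
    rw [← kernel_integral hα0 hα1 hδ h1, ← integral_const_mul, ← integral_const_mul]
    congr 1
    ext u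
    ring

lemma LopA_eq {α δ : ℝ} (h1 : α = 1 → δ = 0) (f : ℝ → ℝ) (x : ℝ) :
    LopA α δ f x = ∫ u, (f (x + u) - f x - cU α u * deriv f x) * nuDens α δ u := by
  unfold LopA
  split_ifs with h
  · have hδ0 := h1 h
    subst h hδ0
    unfold Lop1
    congr 1
    ext u
    have n1 : nuDens 1 0 u = 1 / (π * u ^ 2) := by
      have hr : ∀ t : ℝ, 0 < t → t ^ (-1 - 1 : ℝ) = 1 / t ^ 2 := by
        intro t ht
        rw [show (-1 - 1 : ℝ) = -((2:ℕ):ℝ) by norm_num, rpow_neg ht.le, rpow_natCast, one_div]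
      unfold nuDens dconst
      rw [if_pos rfl]
      split_ifs with hu hu'
      · rw [hr u hu]; ring
      · rw [hr |u| (by simpa using hu'.ne), sq_abs]; ring
      · have : u = 0 := by linarith
        simp [this]
    rw [n1]
    unfold cU
    simp only [if_true]
    split_ifs <;> simp
  · unfold Lop cU
    simp [h]

/-- The complexified Stein operator applied to the inverse Fourier transform. -/
def Ac (α δ : ℝ) (F : 𝓢(ℝ, ℂ)) (x : ℝ) : ℂ :=
  (∫ u, ((𝓕⁻ F) (x + u) - (𝓕⁻ F) x - cU α u * deriv (𝓕⁻ F : 𝓢(ℝ, ℂ)) x) * (nuDens α δ u : ℂ))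
    - (1 / α) * x * deriv (𝓕⁻ F : 𝓢(ℝ, ℂ)) x

/-- Its Fourier side. -/
def GG (α δ : ℝ) (F : 𝓢(ℝ, ℂ)) (ξ : ℝ) : ℂ :=
  F ξ * Psi α δ (2 * π * ξ) + (1 / α) * (F ξ + ξ * deriv F ξ)

lemma sign_mul_rpow {α : ℝ} (hα0 : 0 < α) (l : ℝ) :
    Real.sign l * |l| ^ α = (max l 0) ^ α - (max (-l) 0) ^ α := by
  rcases lt_trichotomy l 0 with h | h | h
  · rw [Real.sign_of_neg h, abs_of_neg h, max_eq_right h.le, max_eq_left (by linarith),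
      zero_rpow hα0.ne']
    ring
  · simp [h]
  · rw [Real.sign_of_pos h, abs_of_pos h, max_eq_left h.le, max_eq_right (by linarith),
      zero_rpow hα0.ne']
    ring

lemma continuous_Psi {α : ℝ} (hα0 : 0 < α) (δ : ℝ) : Continuous (Psi α δ) := by
  have e : Psi α δ = fun l => ((-(|l| ^ α) : ℝ) : ℂ) + Complex.I * δ * ((Real.tan (π * α / 2) : ℝ) : ℂ)
      * (((max l 0) ^ α - (max (-l) 0) ^ α : ℝ) : ℂ) := by
    ext l
    rw [← sign_mul_rpow hα0]
    unfold Psi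
    push_cast
    ring
  have c1 : Continuous fun l : ℝ => |l| ^ α := continuous_abs.rpow_const fun _ => Or.inr hα0.le
  have c2 : Continuous fun l : ℝ => (max l 0) ^ α :=
    (continuous_id.max continuous_const).rpow_const fun _ => Or.inr hα0.le
  have c3 : Continuous fun l : ℝ => (max (-l) 0) ^ α :=
    (continuous_neg.max continuous_const).rpow_const fun _ => Or.inr hα0.le
  rw [e]
  fun_prop

lemma norm_Psi_le {α δ : ℝ} (hα0 : 0 < α) (hα1 : α ≤ 1) (hδ : δ ∈ Set.Ioo (-1 : ℝ) 1)
    (h1 : α = 1 → δ = 0) : ∃ C, ∀ l, ‖Psi α δ l‖ ≤ C * (1 + l ^ 2) := by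
  obtain ⟨m, hm, hm0, hb⟩ := kernel_bound hα0 hα1 hδ
  refine ⟨∫ u, m u, fun l => ?_⟩
  rw [← kernel_integral hα0 hα1 hδ h1, mul_comm, ← integral_const_mul]
  exact norm_integral_le_of_norm_le (hm.const_mul _) (ae_of_all _ fun u => hb l u)

lemma integrable_FPsi {α δ : ℝ} (hα0 : 0 < α) (hα1 : α ≤ 1) (hδ : δ ∈ Set.Ioo (-1 : ℝ) 1)
    (h1 : α = 1 → δ = 0) (F : 𝓢(ℝ, ℂ)) : Integrable (fun ξ => F ξ * Psi α δ (2 * π * ξ)) := by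
  obtain ⟨C, hC⟩ := norm_Psi_le hα0 hα1 hδ h1
  have hc : Continuous (fun ξ => F ξ * Psi α δ (2 * π * ξ)) :=
    F.continuous.mul ((continuous_Psi hα0 δ).comp (by fun_prop))
  refine Integrable.mono' ((integrable_wt F).const_mul C) hc.aestronglyMeasurable
    (ae_of_all _ fun ξ => ?_)
  rw [norm_mul]
  calc _ ≤ ‖F ξ‖ * (C * (1 + (2 * π * ξ) ^ 2)) := by gcongr; exact hC _
    _ = _ := by ring

lemma integrable_Fd (F : 𝓢(ℝ, ℂ)) : Integrable (fun ξ : ℝ => F ξ + ξ * deriv F ξ) := by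
  refine ((SchwartzMap.derivCLM ℂ ℂ (xmul F)).integrable (μ := volume)).congr
    (ae_of_all _ fun ξ => ?_)
  simp only [SchwartzMap.derivCLM_apply, deriv_xmul]

lemma integrable_GG {α δ : ℝ} (hα0 : 0 < α) (hα1 : α ≤ 1) (hδ : δ ∈ Set.Ioo (-1 : ℝ) 1)
    (h1 : α = 1 → δ = 0) (F : 𝓢(ℝ, ℂ)) : Integrable (GG α δ F) :=
  (integrable_FPsi hα0 hα1 hδ h1 F).add ((integrable_Fd F).const_mul _)

lemma Ac_eq {α δ : ℝ} (hα0 : 0 < α) (hα1 : α ≤ 1) (hδ : δ ∈ Set.Ioo (-1 : ℝ) 1)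
    (h1 : α = 1 → δ = 0) (F : 𝓢(ℝ, ℂ)) (x : ℝ) :
    Ac α δ F x = ∫ ξ, ee ξ x * GG α δ F ξ := by
  unfold Ac
  rw [(L_inv hα0 hα1 hδ h1 F x).2, mul_assoc, x_deriv_inv, mul_neg, sub_neg_eq_add,
    ← integral_const_mul, ← integral_add]
  · congr 1
    ext ξ
    unfold GG
    ring
  · exact integrable_ee (integrable_FPsi hα0 hα1 hδ h1 F) x
  · exact (integrable_ee (integrable_Fd F) x).const_mul _

lemma integral_Ac {α δ : ℝ} (hα0 : 0 < α) (hα1 : α ≤ 1) (hδ : δ ∈ Set.Ioo (-1 : ℝ) 1)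
    (h1 : α = 1 → δ = 0) (F : 𝓢(ℝ, ℂ)) (μ : Measure ℝ) [IsProbabilityMeasure μ] :
    Integrable (Ac α δ F) μ ∧ ∫ x, Ac α δ F x ∂μ = ∫ ξ, (∫ x, ee ξ x ∂μ) * GG α δ F ξ := by
  have hG := integrable_GG hα0 hα1 hδ h1 F
  have hp : Integrable (fun p : ℝ × ℝ => ee p.2 p.1 * GG α δ F p.2) (μ.prod volume) := by
    have h := (integrable_const (μ := μ) (1:ℂ)).mul_prod hG
    refine (h.bdd_mul (c := 1) (f := fun p : ℝ × ℝ => ee p.2 p.1) ?_ ?_).congr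
      (ae_of_all _ fun p => ?_)
    · exact (continuous_ee.comp continuous_swap).aestronglyMeasurable
    · exact ae_of_all _ fun p => (norm_ee _ _).le
    · simp
  have e : Ac α δ F = fun x => ∫ ξ, ee ξ x * GG α δ F ξ := by
    ext x; exact Ac_eq hα0 hα1 hδ h1 F x
  rw [e]
  refine ⟨hp.integral_prod_left, ?_⟩
  rw [integral_integral_swap hp]
  congr 1
  ext ξ
  rw [integral_mul_const]

lemma clm_Ac {α δ : ℝ} (hα0 : 0 < α) (hα1 : α ≤ 1) (hδ : δ ∈ Set.Ioo (-1 : ℝ) 1)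
    (h1 : α = 1 → δ = 0) (F : 𝓢(ℝ, ℂ)) (T : ℂ →L[ℝ] ℝ) (f : 𝓢(ℝ, ℝ))
    (hf : ∀ x, f x = T ((𝓕⁻ F) x)) (x : ℝ) :
    LopA α δ f x - (1 / α) * x * deriv f x = T (Ac α δ F x) := by
  have hd : ∀ x, deriv f x = T (deriv (𝓕⁻ F : 𝓢(ℝ, ℂ)) x) := by
    intro x
    have h2 := ((𝓕⁻ F : 𝓢(ℝ, ℂ)).differentiableAt (x := x)).hasDerivAt
    have h3 := T.hasFDerivAt.comp_hasDerivAt x h2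
    have h4 : (f : ℝ → ℝ) = T ∘ (𝓕⁻ F : 𝓢(ℝ, ℂ)) := by ext y; exact hf y
    rw [h4]
    exact h3.deriv
  have hT : ∀ (r : ℝ) (z : ℂ), T (r * z) = r * T z := by
    intro r z
    rw [← Complex.real_smul, map_smul, smul_eq_mul]
  unfold Ac
  rw [LopA_eq h1, map_sub, ← T.integral_comp_comm (L_inv hα0 hα1 hδ h1 F x).1, hd]
  congr 1
  · congr 1
    ext u
    rw [mul_comm _ (nuDens α δ u : ℂ), hT, map_sub, map_sub, hT, hf, hf]
    ring
  · rw [← hT]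
    push_cast
    rfl

lemma main_equiv {α δ : ℝ} (hα0 : 0 < α) (hα1 : α ≤ 1) (hδ : δ ∈ Set.Ioo (-1 : ℝ) 1)
    (h1 : α = 1 → δ = 0) (μ : Measure ℝ) [IsProbabilityMeasure μ] :
    (∀ f : 𝓢(ℝ, ℝ), (∫ x, (LopA α δ f x - (1/α) * x * deriv f x) ∂μ) = 0) ↔
      ∀ F : 𝓢(ℝ, ℂ), ∫ ξ, (∫ x, ee ξ x ∂μ) * GG α δ F ξ = 0 := by
  constructor
  · intro h F
    obtain ⟨hi, he⟩ := integral_Ac hα0 hα1 hδ h1 F μ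
    rw [← he]
    have hT : ∀ T : ℂ →L[ℝ] ℝ, T (∫ x, Ac α δ F x ∂μ) = 0 := by
      intro T
      rw [← T.integral_comp_comm hi, ← h (SchwartzMap.postcompCLM T (𝓕⁻ F : 𝓢(ℝ, ℂ)))]
      congr 1
      ext x
      exact (clm_Ac hα0 hα1 hδ h1 F T _ (fun y => rfl) x).symm
    exact Complex.ext (hT Complex.reCLM) (hT Complex.imCLM)
  · intro h f
    let fc : 𝓢(ℝ, ℂ) := SchwartzMap.postcompCLM Complex.ofRealCLM f
    let F : 𝓢(ℝ, ℂ) := 𝓕 fc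
    have hF : (𝓕⁻ F : 𝓢(ℝ, ℂ)) = fc := FourierTransform.fourierInv_fourier_eq fc
    obtain ⟨hi, he⟩ := integral_Ac hα0 hα1 hδ h1 F μ
    have := Complex.reCLM.integral_comp_comm hi
    rw [he, h F, map_zero] at this
    rw [← this]
    congr 1
    ext x
    refine clm_Ac hα0 hα1 hδ h1 F Complex.reCLM f (fun y => ?_) x
    rw [hF]
    rfl

lemma hasDerivAt_Psi (α δ : ℝ) {l : ℝ} (hl : l ≠ 0) :
    HasDerivAt (Psi α δ) (α * Psi α δ l / l) l := by
  have hs : ∀ᶠ y in 𝓝 l, Real.sign y = Real.sign l := by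
    rcases lt_or_gt_of_ne hl with h | h
    · filter_upwards [gt_mem_nhds h] with y hy
      rw [Real.sign_of_neg hy, Real.sign_of_neg h]
    · filter_upwards [lt_mem_nhds h] with y hy
      rw [Real.sign_of_pos hy, Real.sign_of_pos h]
  have hd : HasDerivAt (fun y : ℝ => |y| ^ α) (α * |l| ^ α / l) l := by
    have h1 := (hasDerivAt_abs hl).rpow_const (p := α) (Or.inl (abs_ne_zero.2 hl))
    refine h1.congr_deriv ?_
    have : |l| ^ α = |l| ^ (α - 1) * |l| := by
      rw [rpow_sub_one (abs_ne_zero.2 hl)]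
      field_simp [abs_ne_zero.2 hl]
    rw [this]
    have h3 : (SignType.sign l : ℝ) * |l| = l := sign_mul_abs l
    have h4 : |l| / l = SignType.sign l := by
      rcases lt_or_gt_of_ne hl with h | h
      · rw [abs_of_neg h, sign_neg h]; field_simp; simp
      · rw [abs_of_pos h, sign_pos h]; field_simp; simp
    rw [← h4]
    ring
  have h2 := (hd.neg.ofReal_comp).mul_const
    (1 - Complex.I * (δ : ℂ) * ((Real.sign l : ℝ) : ℂ) * ((Real.tan (π * α / 2) : ℝ) : ℂ))
  refine (h2.congr_of_eventuallyEq ?_).congr_deriv ?_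
  · filter_upwards [hs] with y hy
    unfold Psi
    rw [hy]
    rfl
  · unfold Psi
    push_cast
    ring

lemma hasDerivAt_Psi' (α δ : ℝ) {ξ : ℝ} (hl : ξ ≠ 0) :
    HasDerivAt (fun ξ => Psi α δ (2 * π * ξ)) (α * Psi α δ (2 * π * ξ) / ξ) ξ := by
  have hpi : 2 * π ≠ 0 := by positivity
  have h1 := hasDerivAt_Psi α δ (l := 2 * π * ξ) (mul_ne_zero hpi hl)
  have h2 : HasDerivAt (fun ξ : ℝ => 2 * π * ξ) (2 * π) ξ := by
    simpa using (hasDerivAt_id ξ).const_mul (2 * π)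
  have h3 := h1.scomp ξ h2
  refine h3.congr_deriv ?_
  have hc : (ξ:ℂ) ≠ 0 := by exact_mod_cast hl
  have hpc : (π:ℂ) ≠ 0 := by exact_mod_cast Real.pi_ne_zero
  rw [Complex.real_smul]
  push_cast
  field_simp

lemma Psi_re (α δ l : ℝ) : (Psi α δ l).re = -(|l| ^ α) := by
  unfold Psi
  rw [Complex.re_ofReal_mul]
  have : Complex.I * (δ : ℂ) * ((Real.sign l : ℝ) : ℂ) * ((Real.tan (π * α / 2) : ℝ) : ℂ)
    = Complex.I * ((δ * Real.sign l * Real.tan (π * α / 2) : ℝ) : ℂ) := by push_cast; ring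
  rw [this]
  simp only [Complex.sub_re, Complex.one_re, Complex.I_mul_re, Complex.ofReal_im]
  ring

lemma Psi_zero {α : ℝ} (hα0 : 0 < α) (δ : ℝ) : Psi α δ 0 = 0 := by
  unfold Psi
  simp [zero_rpow hα0.ne']

lemma norm_exp_Psi (α δ l : ℝ) : ‖Complex.exp (Psi α δ l)‖ ≤ 1 := by
  apply norm_exp_le_one
  rw [Psi_re]
  have := rpow_nonneg (abs_nonneg l) α
  linarith

lemma hasDerivAt_mul_zero {h : ℝ → ℂ} (hh : ContinuousAt h 0) :
    HasDerivAt (fun ξ : ℝ => (ξ:ℂ) * h ξ) (h 0) 0 := by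
  rw [hasDerivAt_iff_tendsto_slope]
  refine (hh.tendsto.mono_left nhdsWithin_le_nhds).congr' ?_
  filter_upwards [self_mem_nhdsWithin] with ξ hξ
  have hc : (ξ:ℂ) ≠ 0 := by exact_mod_cast hξ
  rw [slope_def_module]
  simp only [sub_zero, Complex.ofReal_zero, zero_mul]
  rw [Complex.real_smul]
  push_cast
  field_simp

lemma hasDerivAt_P {α : ℝ} (hα0 : 0 < α) (δ : ℝ) (F : 𝓢(ℝ, ℂ)) (ξ : ℝ) :
    HasDerivAt (fun ξ : ℝ => (ξ:ℂ) * (F ξ * Complex.exp (Psi α δ (2 * π * ξ))))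
      (α * (Complex.exp (Psi α δ (2 * π * ξ)) * GG α δ F ξ)) ξ := by
  have hαc : (α:ℂ) ≠ 0 := by exact_mod_cast hα0.ne'
  have hcP : Continuous fun ξ => Psi α δ (2 * π * ξ) :=
    (continuous_Psi hα0 δ).comp (continuous_const.mul continuous_id)
  by_cases h : ξ = 0
  · subst h
    refine (hasDerivAt_mul_zero ?_).congr_deriv ?_
    · exact (F.continuous.mul (Complex.continuous_exp.comp hcP)).continuousAt
    · unfold GG
      rw [mul_zero, Psi_zero hα0]
      simp
      field_simp
  · have h1 : HasDerivAt (fun ξ : ℝ => (ξ:ℂ)) 1 ξ := Complex.ofRealCLM.hasDerivAt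
    have h2 := F.differentiableAt.hasDerivAt (x := ξ)
    have h3 := (hasDerivAt_Psi' α δ h).cexp
    refine (h1.mul (h2.mul h3)).congr_deriv ?_
    have hc : (ξ:ℂ) ≠ 0 := by exact_mod_cast h
    unfold GG
    simp only [Pi.mul_apply]
    field_simp
    ring

lemma forward {α δ : ℝ} (hα0 : 0 < α) (hα1 : α ≤ 1) (hδ : δ ∈ Set.Ioo (-1 : ℝ) 1)
    (h1 : α = 1 → δ = 0) (F : 𝓢(ℝ, ℂ)) :
    ∫ ξ, Complex.exp (Psi α δ (2 * π * ξ)) * GG α δ F ξ = 0 := by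
  have hαc : (α:ℂ) ≠ 0 := by exact_mod_cast hα0.ne'
  have hcP : Continuous fun ξ => Complex.exp (Psi α δ (2 * π * ξ)) :=
    Complex.continuous_exp.comp ((continuous_Psi hα0 δ).comp (continuous_const.mul continuous_id))
  have hi : Integrable fun ξ => (α:ℂ) * (Complex.exp (Psi α δ (2 * π * ξ)) * GG α δ F ξ) := by
    refine Integrable.const_mul ?_ _
    refine (integrable_GG hα0 hα1 hδ h1 F).bdd_mul (c := 1) hcP.aestronglyMeasurable
      (ae_of_all _ fun ξ => norm_exp_Psi _ _ _)
  have hi2 : Integrable (fun ξ : ℝ => (ξ:ℂ) * (F ξ * Complex.exp (Psi α δ (2 * π * ξ)))) := by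
    refine (((xmul F).integrable (μ := volume)).bdd_mul (c := 1) hcP.aestronglyMeasurable
      (ae_of_all _ fun ξ => norm_exp_Psi _ _ _)).congr (ae_of_all _ fun ξ => ?_)
    simp only [xmul_apply]
    ring
  have := integral_eq_zero_of_hasDerivAt_of_integrable (hasDerivAt_P hα0 δ F) hi hi2
  rw [integral_const_mul] at this
  exact (mul_eq_zero.1 this).resolve_left hαc

lemma stableCF_eq {α δ : ℝ} (h1 : α = 1 → δ = 0) (l : ℝ) :
    stableCF α δ 1 l = Complex.exp (Psi α δ l) := by
  unfold stableCF Psi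
  split_ifs with h
  · rw [h1 h, h]
    simp
  · rw [one_mul]

open scoped ContDiff

lemma contDiffAt_Psi' (α δ : ℝ) {ξ : ℝ} (hl : ξ ≠ 0) :
    ContDiffAt ℝ ∞ (fun ξ => Psi α δ (2 * π * ξ)) ξ := by
  have hpi : 0 < 2 * π := by positivity
  have hs : ∀ᶠ y in 𝓝 ξ, Real.sign (2 * π * y) = Real.sign (2 * π * ξ) := by
    rcases lt_or_gt_of_ne hl with h | h
    · filter_upwards [gt_mem_nhds h] with y hy
      rw [Real.sign_of_neg (mul_neg_of_pos_of_neg hpi hy),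
        Real.sign_of_neg (mul_neg_of_pos_of_neg hpi h)]
    · filter_upwards [lt_mem_nhds h] with y hy
      rw [Real.sign_of_pos (mul_pos hpi hy), Real.sign_of_pos (mul_pos hpi h)]
  have h0 : ContDiffAt ℝ ∞ (fun y : ℝ => 2 * π * y) ξ := by fun_prop
  have hne : 2 * π * ξ ≠ 0 := mul_ne_zero hpi.ne' hl
  have h1 : ContDiffAt ℝ ∞ (fun y : ℝ => |2 * π * y|) ξ := (contDiffAt_abs hne).comp ξ h0
  have h2 : ContDiffAt ℝ ∞ (fun y : ℝ => |2 * π * y| ^ α) ξ :=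
    h1.rpow_const_of_ne (abs_ne_zero.2 hne)
  have h3 : ContDiffAt ℝ ∞ (fun y : ℝ => ((-(|2 * π * y| ^ α) : ℝ) : ℂ)) ξ :=
    Complex.ofRealCLM.contDiff.contDiffAt.comp ξ h2.neg
  refine ContDiffAt.congr_of_eventuallyEq (h3.mul (contDiffAt_const
    (c := (1 - Complex.I * (δ : ℂ) * ((Real.sign (2 * π * ξ) : ℝ) : ℂ)
      * ((Real.tan (π * α / 2) : ℝ) : ℂ))))) ?_
  filter_upwards [hs] with y hy
  unfold Psi
  rw [hy]

/-- characteristic function divided by the target -/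
def gg (α δ : ℝ) (μ : Measure ℝ) (ξ : ℝ) : ℂ :=
  (∫ x, ee ξ x ∂μ) * Complex.exp (-Psi α δ (2 * π * ξ))

lemma continuous_gg {α : ℝ} (hα0 : 0 < α) (δ : ℝ) (μ : Measure ℝ) [IsProbabilityMeasure μ] :
    Continuous (gg α δ μ) := by
  have h1 : Continuous fun ξ => ∫ x, ee ξ x ∂μ := by
    refine continuous_of_dominated (bound := fun _ => 1) (fun ξ => ?_) (fun ξ => ?_)
      (integrable_const _) (ae_of_all _ fun x => ?_)
    · exact (continuous_ee.comp (by fun_prop : Continuous fun x : ℝ => (ξ, x))).aestronglyMeasurable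
    · exact ae_of_all _ fun x => (norm_ee ξ x).le
    · exact continuous_ee.comp (by fun_prop : Continuous fun ξ : ℝ => (ξ, x))
  exact h1.mul (Complex.continuous_exp.comp
    ((continuous_Psi hα0 δ).comp (continuous_const.mul continuous_id)).neg)

lemma gg_zero {α : ℝ} (hα0 : 0 < α) (δ : ℝ) (μ : Measure ℝ) [IsProbabilityMeasure μ] :
    gg α δ μ 0 = 1 := by
  unfold gg ee
  simp [Psi_zero hα0]

lemma stepA {α δ : ℝ} (hα0 : 0 < α) (μ : Measure ℝ)
    (hG : ∀ F : 𝓢(ℝ, ℂ), ∫ ξ, (∫ x, ee ξ x ∂μ) * GG α δ F ξ = 0)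
    {H : ℝ → ℝ} (hH : ContDiff ℝ ∞ H) (hc : HasCompactSupport H) (h0 : H =ᶠ[𝓝 0] 0) :
    ∫ ξ, ((deriv H ξ : ℝ) : ℂ) * gg α δ μ ξ = 0 := by
  have hαc : (α:ℂ) ≠ 0 := by exact_mod_cast hα0.ne'
  let f : ℝ → ℂ := fun ξ => (H ξ : ℂ) * (Complex.exp (-Psi α δ (2 * π * ξ)) * (ξ:ℂ)⁻¹)
  have hHc : ContDiff ℝ ∞ (fun ξ => (H ξ : ℂ)) := Complex.ofRealCLM.contDiff.comp hH
  have hf : ContDiff ℝ ∞ f := by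
    rw [contDiff_iff_contDiffAt]
    intro ξ
    by_cases h : ξ = 0
    · subst h
      refine (contDiffAt_const (c := (0:ℂ))).congr_of_eventuallyEq ?_
      filter_upwards [h0] with y hy
      simp [f, hy]
    · have hc : (ξ:ℂ) ≠ 0 := by exact_mod_cast h
      have e1 : ContDiffAt ℝ ∞ (fun ξ => Complex.exp (-Psi α δ (2 * π * ξ))) ξ :=
        (contDiffAt_Psi' α δ h).neg.cexp
      have e2 : ContDiffAt ℝ ∞ (fun ξ : ℝ => (ξ:ℂ)⁻¹) ξ :=
        (Complex.ofRealCLM.contDiff.contDiffAt (x := ξ)).inv hc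
      exact hHc.contDiffAt.mul (e1.mul e2)
  have hfc : HasCompactSupport f := by
    have : HasCompactSupport (fun ξ => (H ξ : ℂ)) := hc.comp_left (g := fun r : ℝ => (r:ℂ)) rfl
    exact this.mul_right
  let F : 𝓢(ℝ, ℂ) := hfc.toSchwartzMap hf
  have hF : ∀ ξ, F ξ = f ξ := fun ξ => rfl
  have hx : ∀ ξ, xmul F ξ = (H ξ : ℂ) * Complex.exp (-Psi α δ (2 * π * ξ)) := by
    intro ξ
    rw [xmul_apply, hF]
    by_cases h : ξ = 0
    · subst h
      simp [f, h0.eq_of_nhds]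
    · have hc : (ξ:ℂ) ≠ 0 := by exact_mod_cast h
      simp only [f]
      field_simp
  have hae : ∀ᵐ ξ : ℝ, (∫ x, ee ξ x ∂μ) * GG α δ F ξ = (1 / α) * (((deriv H ξ : ℝ) : ℂ) * gg α δ μ ξ) := by
    have : ∀ᵐ ξ : ℝ, ξ ≠ 0 := by simp [ae_iff]
    filter_upwards [this] with ξ h
    have hc : (ξ:ℂ) ≠ 0 := by exact_mod_cast h
    have d1 : deriv (xmul F) ξ = ((deriv H ξ : ℝ) : ℂ) * Complex.exp (-Psi α δ (2 * π * ξ))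
        + H ξ * (Complex.exp (-Psi α δ (2 * π * ξ)) * (-(α * Psi α δ (2 * π * ξ) / ξ))) := by
      rw [show (xmul F : ℝ → ℂ) = fun ξ => (H ξ : ℂ) * Complex.exp (-Psi α δ (2 * π * ξ)) from
        funext hx]
      have a1 : HasDerivAt (fun ξ => (H ξ : ℂ)) ((deriv H ξ : ℝ) : ℂ) ξ :=
        ((hH.differentiable (by simp)).differentiableAt (x := ξ)).hasDerivAt.ofReal_comp
      exact (a1.mul (hasDerivAt_Psi' α δ h).neg.cexp).deriv
    unfold GG gg
    rw [← deriv_xmul, d1, hF]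
    simp only [f]
    field_simp
    ring
  have := hG F
  rw [integral_congr_ae hae, integral_const_mul] at this
  exact (mul_eq_zero.1 this).resolve_left (by simpa using hαc)

lemma stepB {α δ : ℝ} (hα0 : 0 < α) (μ : Measure ℝ) [IsProbabilityMeasure μ]
    (hG : ∀ F : 𝓢(ℝ, ℂ), ∫ ξ, (∫ x, ee ξ x ∂μ) * GG α δ F ξ = 0)
    {k : ℝ → ℝ} (hk : ContDiff ℝ ∞ k) (hc : HasCompactSupport k) (h0 : tsupport k ⊆ {0}ᶜ)
    {s : ℝ} (hs0 : 0 < s) (hs1 : s < 1) :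
    ∫ y, (k y : ℂ) * gg α δ μ (s * y) = ∫ y, (k y : ℂ) * gg α δ μ y := by
  have hkc := hk.continuous
  -- support information
  obtain ⟨R, hR0, hR⟩ : ∃ R > 0, ∀ x, R ≤ |x| → k x = 0 := by
    obtain ⟨R, hR⟩ := hc.isCompact.isBounded.subset_closedBall 0
    refine ⟨|R| + 1, by positivity, fun x hx => ?_⟩
    by_contra hne
    have := hR (subset_tsupport k hne)
    rw [mem_closedBall_zero_iff, Real.norm_eq_abs] at this
    linarith [le_abs_self R]
  obtain ⟨ε, hε0, hε⟩ : ∃ ε > 0, ∀ x, |x| < ε → k x = 0 := by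
    have : (tsupport k)ᶜ ∈ 𝓝 (0:ℝ) :=
      (isClosed_tsupport k).isOpen_compl.mem_nhds fun h => h0 h rfl
    obtain ⟨ε, he, hb⟩ := Metric.mem_nhds_iff.1 this
    refine ⟨ε, he, fun x hx => ?_⟩
    exact image_eq_zero_of_notMem_tsupport (hb (by simpa using hx))
  let K : ℝ → ℝ := fun x => ∫ t in (0:ℝ)..x, k t
  have hKd : ∀ x, HasDerivAt K (k x) x := fun x =>
    (hkc.integral_hasStrictDerivAt 0 x).hasDerivAt
  have hKs : ContDiff ℝ ∞ K := by
    rw [contDiff_infty_iff_deriv]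
    refine ⟨fun x => (hKd x).differentiableAt, ?_⟩
    rw [show deriv K = k from funext fun x => (hKd x).deriv]
    exact hk
  have hK0 : ∀ x, |x| < ε → K x = 0 := by
    intro x hx
    refine intervalIntegral.integral_zero_ae (ae_of_all _ fun t ht => ?_)
    apply hε
    rcases mem_uIoc.1 ht with ⟨h1, h2⟩ | ⟨h1, h2⟩
    · rw [abs_lt] at *; constructor <;> linarith
    · rw [abs_lt] at *; constructor <;> linarith
  have hKK : ∀ x y, (∀ t ∈ uIoc x y, k t = 0) → K y = K x := by
    intro x y h
    have h1 : K y - K x = ∫ t in x..y, k t :=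
      intervalIntegral.integral_interval_sub_left (hkc.intervalIntegrable _ _)
        (hkc.intervalIntegrable _ _)
    rw [intervalIntegral.integral_zero_ae (ae_of_all _ h)] at h1
    linarith
  let H : ℝ → ℝ := fun x => K x - K (x / s)
  have hHs : ContDiff ℝ ∞ H := hKs.sub (hKs.comp (by fun_prop : ContDiff ℝ ∞ fun x : ℝ => x / s))
  have hHd : ∀ x, deriv H x = k x - k (x / s) / s := by
    intro x
    have h2 : HasDerivAt (fun x : ℝ => x / s) (1 / s) x := (hasDerivAt_id x).div_const s
    have h3 := ((hKd x).sub ((hKd (x / s)).comp x h2)).deriv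
    refine h3.trans ?_
    ring
  have hHc : HasCompactSupport H := by
    refine HasCompactSupport.intro (isCompact_Icc (a := -R) (b := R)) fun x hx => ?_
    have hx' : R < x ∨ x < -R := by
      by_contra hcon
      push Not at hcon
      exact hx ⟨hcon.2, hcon.1⟩
    have : K (x / s) = K x := by
      apply hKK
      intro t ht
      apply hR
      rcases hx' with h | h
      · have : x ≤ x / s := by rw [le_div_iff₀ hs0]; nlinarith
        rw [uIoc_of_le this] at ht
        exact le_trans (by linarith [ht.1]) (le_abs_self t)
      · have : x / s ≤ x := by rw [div_le_iff₀ hs0]; nlinarith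
        rw [uIoc_of_ge this] at ht
        exact le_trans (by linarith [ht.2]) (neg_le_abs t)
    simp only [H, this, sub_self]
  have hH0 : H =ᶠ[𝓝 0] 0 := by
    have : Metric.ball (0:ℝ) (s * ε) ∈ 𝓝 (0:ℝ) := Metric.ball_mem_nhds _ (by positivity)
    filter_upwards [this] with x hx
    rw [mem_ball_zero_iff, Real.norm_eq_abs] at hx
    have h1 : |x| < ε := by nlinarith
    have h2 : |x / s| < ε := by
      rw [abs_div, abs_of_pos hs0, div_lt_iff₀ hs0]; linarith
    simp only [H, hK0 x h1, hK0 _ h2, sub_self, Pi.zero_apply]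
  have hA := stepA hα0 μ hG hHs hHc hH0
  have hgc := continuous_gg hα0 δ μ
  have hkC : Continuous fun y => (k y : ℂ) := Complex.continuous_ofReal.comp hkc
  have hkS : HasCompactSupport fun y => (k y : ℂ) := hc.comp_left (g := fun r : ℝ => (r:ℂ)) rfl
  have i1 : Integrable fun y => (k y : ℂ) * gg α δ μ y :=
    (hkC.mul hgc).integrable_of_hasCompactSupport hkS.mul_right
  have i2 : Integrable fun y => (k y : ℂ) * gg α δ μ (s * y) :=
    (hkC.mul (hgc.comp (continuous_const.mul continuous_id))).integrable_of_hasCompactSupport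
      hkS.mul_right
  have hsc : (s:ℂ) ≠ 0 := by exact_mod_cast hs0.ne'
  have e2 : ∀ x, (fun y => (s:ℂ)⁻¹ * ((k y : ℂ) * gg α δ μ (s * y))) (x / s)
      = (k (x / s) : ℂ) / s * gg α δ μ x := by
    intro x
    simp only
    rw [mul_div_cancel₀ x hs0.ne']
    ring
  have hA' : ∫ x, ((k x : ℂ) * gg α δ μ x - (k (x / s) : ℂ) / s * gg α δ μ x) = 0 := by
    rw [← hA]
    congr 1
    ext x
    rw [hHd]
    push_cast
    ring
  have i3 : Integrable fun x => (k (x / s) : ℂ) / s * gg α δ μ x := by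
    have := (i2.const_mul (s:ℂ)⁻¹).comp_div hs0.ne'
    exact this.congr (ae_of_all _ e2)
  rw [integral_sub i1 i3, sub_eq_zero] at hA'
  rw [hA', ← integral_congr_ae (ae_of_all _ e2), Measure.integral_comp_div
      (fun y => (s:ℂ)⁻¹ * ((k y : ℂ) * gg α δ μ (s * y))) s, integral_const_mul,
    abs_of_pos hs0, Complex.real_smul, ← mul_assoc, mul_inv_cancel₀ hsc, one_mul]

lemma stepC {α δ : ℝ} (hα0 : 0 < α) (μ : Measure ℝ) [IsProbabilityMeasure μ]
    (hG : ∀ F : 𝓢(ℝ, ℂ), ∫ ξ, (∫ x, ee ξ x ∂μ) * GG α δ F ξ = 0)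
    {k : ℝ → ℝ} (hk : ContDiff ℝ ∞ k) (hc : HasCompactSupport k) (h0 : tsupport k ⊆ {0}ᶜ) :
    ∫ y, k y • (gg α δ μ y - 1) = 0 := by
  have hgc := continuous_gg hα0 δ μ
  have hkC : Continuous fun y => (k y : ℂ) := Complex.continuous_ofReal.comp hk.continuous
  have hkS : HasCompactSupport fun y => (k y : ℂ) := hc.comp_left (g := fun r : ℝ => (r:ℂ)) rfl
  have hJ : ContinuousOn (fun s : ℝ => ∫ y, (k y : ℂ) * gg α δ μ (s * y)) univ := by
    refine continuousOn_integral_of_compact_support (k := tsupport k) hc.isCompact ?_ ?_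
    · refine Continuous.continuousOn ?_
      exact (hkC.comp continuous_snd).mul (hgc.comp (continuous_fst.mul continuous_snd))
    · intro s y _ hy
      rw [image_eq_zero_of_notMem_tsupport hy]
      simp
  have t1 : Tendsto (fun s : ℝ => ∫ y, (k y : ℂ) * gg α δ μ (s * y)) (𝓝[>] 0)
      (𝓝 (∫ y, (k y : ℂ) * gg α δ μ (0 * y))) :=
    ((continuousOn_univ.1 hJ).tendsto 0).mono_left nhdsWithin_le_nhds
  have t2 : Tendsto (fun s : ℝ => ∫ y, (k y : ℂ) * gg α δ μ (s * y)) (𝓝[>] 0)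
      (𝓝 (∫ y, (k y : ℂ) * gg α δ μ y)) := by
    refine tendsto_const_nhds.congr' ?_
    filter_upwards [Ioo_mem_nhdsGT (show (0:ℝ) < 1 by norm_num)] with s hs
    exact (stepB hα0 μ hG hk hc h0 hs.1 hs.2).symm
  have h := tendsto_nhds_unique t2 t1
  simp only [zero_mul, gg_zero hα0, mul_one] at h
  have i1 : Integrable fun y => (k y : ℂ) * gg α δ μ y :=
    (hkC.mul hgc).integrable_of_hasCompactSupport hkS.mul_right
  have i2 : Integrable fun y => (k y : ℂ) := hkC.integrable_of_hasCompactSupport hkS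
  have : ∀ y, k y • (gg α δ μ y - 1) = (k y : ℂ) * gg α δ μ y - k y := by
    intro y
    rw [Complex.real_smul]; ring
  simp only [this]
  rw [integral_sub i1 i2, h, sub_self]

lemma backward {α δ : ℝ} (hα0 : 0 < α) (μ : Measure ℝ) [IsProbabilityMeasure μ]
    (hG : ∀ F : 𝓢(ℝ, ℂ), ∫ ξ, (∫ x, ee ξ x ∂μ) * GG α δ F ξ = 0) (ξ : ℝ) :
    ∫ x, ee ξ x ∂μ = Complex.exp (Psi α δ (2 * π * ξ)) := by
  have hgc := continuous_gg hα0 δ μ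
  have hc1 : Continuous fun y => gg α δ μ y - 1 := hgc.sub continuous_const
  have h1 := (isOpen_compl_singleton (x := (0:ℝ))).ae_eq_zero_of_integral_contDiff_smul_eq_zero
    (μ := volume) (hc1.locallyIntegrable.locallyIntegrableOn _)
    (fun k hk hc h0 => stepC hα0 μ hG hk hc h0)
  have h2 : ∀ᵐ y : ℝ, y ≠ 0 := by simp [ae_iff]
  have h3 : (gg α δ μ) =ᵐ[volume] fun _ => (1:ℂ) := by
    filter_upwards [h1, h2] with y hy hy'
    exact sub_eq_zero.1 (hy hy')
  have h4 := congrFun ((hgc.ae_eq_iff_eq volume continuous_const).1 h3) ξ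
  unfold gg at h4
  rw [Complex.exp_neg] at h4
  have hne := Complex.exp_ne_zero (Psi α δ (2 * π * ξ))
  field_simp at h4
  exact h4

lemma stable_iff {α δ : ℝ} (h1 : α = 1 → δ = 0) (μ : Measure ℝ) :
    IsStableLaw α δ μ ↔ ∀ ξ, ∫ x, ee ξ x ∂μ = Complex.exp (Psi α δ (2 * π * ξ)) := by
  unfold IsStableLaw ee
  simp only [stableCF_eq h1]
  constructor
  · intro h ξ
    exact h (2 * π * ξ)
  · intro h l
    have := h (l / (2 * π))
    rwa [mul_div_cancel₀ l (by positivity)] at this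

end StableAux

/-- Proposition 2.4: `Y ~ S_α(δ)` iff `E[A_{α,δ} f(Y)] = 0` for all Schwartz functions `f`,
where `A_{α,δ} f(x) = L^{α,δ} f(x) - (1/α) x f'(x)`. -/
theorem stable_characterization
    (α δ : ℝ) (hα0 : 0 < α) (hα1 : α ≤ 1) (hδ : δ ∈ Set.Ioo (-1 : ℝ) 1)
    (h1 : α = 1 → δ = 0)
    (μ : Measure ℝ) [IsProbabilityMeasure μ] :
    IsStableLaw α δ μ ↔
      ∀ f : SchwartzMap ℝ ℝ,
        (∫ x, (LopA α δ f x - (1/α) * x * deriv f x) ∂μ) = 0 := by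
  rw [StableAux.main_equiv hα0 hα1 hδ h1, StableAux.stable_iff h1]
  constructor
  · intro h F
    simp only [h]
    exact StableAux.forward hα0 hα1 hδ h1 F
  · intro h ξ
    exact StableAux.backward hα0 μ h ξ
end
end

section
/- Let α ∈ (0,1], δ ∈ (-1,1) (with δ = 0 if α = 1), and for t > 0 let p_t denote the density of the α-stable law with characteristic function λ ↦ exp(−t|λ|^α(1 − iδ sign(λ) tan(πα/2))) (λ ↦ exp(−t|λ|) when α = 1). Then there is a constant C_α > 0 such that for all t > 0 and x ∈ ℝ, p_t(x) ≤ C_α t / (t^{1/α} + |x|)^{α+1}. -/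
open MeasureTheory Real Filter Set
open scoped Topology

noncomputable section

def GG (α t x : ℝ) (c : ℂ) (l : ℝ) : ℂ :=
  Complex.exp (-(Complex.I * l * x) - ((t * l ^ α : ℝ) : ℂ) * c)

lemma GG_cont {α t x : ℝ} {c : ℂ} (hα : 0 < α) : Continuous (GG α t x c) := by
  have : Continuous (fun l : ℝ => l ^ α) := Real.continuous_rpow_const hα.le
  unfold GG
  fun_prop

lemma GG_norm {α t x : ℝ} {c : ℂ} (hc : c.re = 1) (l : ℝ) :
    ‖GG α t x c l‖ = Real.exp (-t * l ^ α) := by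
  unfold GG
  rw [Complex.norm_exp]
  congr 1
  simp [hc]

lemma GG_deriv {α t x : ℝ} {c : ℂ} {l : ℝ} (hl : 0 < l) :
    HasDerivAt (GG α t x c)
      (-(Complex.I * x) * GG α t x c l - ((t * α * l ^ (α - 1) : ℝ) : ℂ) * c * GG α t x c l) l := by
  have h1 : HasDerivAt (fun l : ℝ => t * l ^ α) (t * (α * l ^ (α - 1))) l :=
    (Real.hasDerivAt_rpow_const (Or.inl hl.ne')).const_mul t
  have h2 := (h1.ofReal_comp).mul_const c
  have h3 : HasDerivAt (fun l : ℝ => -(Complex.I * (l : ℂ) * x)) (-(Complex.I * 1 * x)) l :=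
    (((hasDerivAt_id l).ofReal_comp.const_mul Complex.I).mul_const (x : ℂ)).neg
  have h4 := (h3.sub h2).cexp
  refine h4.congr_deriv ?_
  unfold GG
  push_cast
  simp only [Pi.sub_apply]
  push_cast
  ring

def KK (α t x : ℝ) (c : ℂ) (l : ℝ) : ℂ := ((t * α * l ^ (α - 1) : ℝ) : ℂ) * c * GG α t x c l

def RR (α t x : ℝ) (c : ℂ) (l : ℝ) : ℂ :=
  ((t * α * ((α - 1) * l ^ (α - 1 - 1)) : ℝ) : ℂ) * c * GG α t x c l
    - ((t * α * l ^ (α - 1) : ℝ) : ℂ) * c * KK α t x c l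

lemma KK_deriv {α t x : ℝ} {c : ℂ} {l : ℝ} (hl : 0 < l) :
    HasDerivAt (KK α t x c) (-(Complex.I * x) * KK α t x c l + RR α t x c l) l := by
  have h1 : HasDerivAt (fun l : ℝ => t * α * l ^ (α - 1))
      (t * α * ((α - 1) * l ^ (α - 1 - 1))) l :=
    (Real.hasDerivAt_rpow_const (Or.inl hl.ne')).const_mul (t * α)
  have h2 := ((h1.ofReal_comp).mul_const c).mul (GG_deriv (α := α) (t := t) (x := x) (c := c) hl)
  refine h2.congr_deriv ?_
  unfold RR KK
  ring

lemma KK_norm {α t x : ℝ} {c : ℂ} (hα : 0 < α) (ht : 0 < t) (hc : c.re = 1) {l : ℝ} (hl : 0 < l) :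
    ‖KK α t x c l‖ = t * α * ‖c‖ * (l ^ (α - 1) * Real.exp (-t * l ^ α)) := by
  unfold KK
  rw [norm_mul, norm_mul, GG_norm hc, Complex.norm_real, Real.norm_of_nonneg (by positivity)]
  ring

lemma KK_le {α t x : ℝ} {c : ℂ} (hα : 0 < α) (ht : 0 < t) (hc : c.re = 1) {l : ℝ} (hl : 0 < l) :
    ‖KK α t x c l‖ ≤ t * α * ‖c‖ * l ^ (α - 1) := by
  rw [KK_norm hα ht hc hl]
  have : Real.exp (-t * l ^ α) ≤ 1 := by
    rw [Real.exp_le_one_iff]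
    have := Real.rpow_nonneg hl.le α
    nlinarith
  have h2 := Real.rpow_nonneg hl.le (α - 1)
  have : l ^ (α - 1) * Real.exp (-t * l ^ α) ≤ l ^ (α - 1) := mul_le_of_le_one_right h2 this
  gcongr

lemma RR_le {α t x : ℝ} {c : ℂ} (hα : 0 < α) (hα1 : α < 1) (ht : 0 < t) (hc : c.re = 1)
    {l : ℝ} (hl : 0 < l) :
    ‖RR α t x c l‖ ≤ t * (‖c‖ + ‖c‖ ^ 2) * l ^ (α - 2) := by
  unfold RR
  refine (norm_sub_le _ _).trans ?_
  rw [norm_mul, norm_mul, norm_mul, norm_mul, KK_norm hα ht hc hl, GG_norm hc, Complex.norm_real,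
    Complex.norm_real]
  have hp2 : 0 < l ^ (α - 2) := Real.rpow_pos_of_pos hl _
  have hp1 : 0 < l ^ (α - 1) := Real.rpow_pos_of_pos hl _
  have hp0 : 0 < l ^ α := Real.rpow_pos_of_pos hl _
  have e1 : l ^ (α - 1 - 1) = l ^ (α - 2) := by congr 1; ring
  have e2 : l ^ (α - 1) * l ^ (α - 1) = l ^ α * l ^ (α - 2) := by
    rw [← Real.rpow_add hl, ← Real.rpow_add hl]; congr 1; ring
  rw [e1, Real.norm_eq_abs, Real.norm_eq_abs, abs_of_nonneg (a := t * α * l ^ (α - 1)) (by positivity)]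
  have e3 : |t * α * ((α - 1) * l ^ (α - 2))| = t * (α * (1 - α)) * l ^ (α - 2) := by
    rw [abs_of_nonpos]
    · ring
    · have : 0 ≤ t * α * ((1 - α) * l ^ (α - 2)) := by
        have : 0 < 1 - α := by linarith
        positivity
      linarith
  rw [e3]
  set e := Real.exp (-t * l ^ α) with he
  have he0 : 0 < e := Real.exp_pos _
  have he1 : e ≤ 1 := by
    rw [he, Real.exp_le_one_iff]; nlinarith
  have he2 : (t * l ^ α) * e ≤ 1 := by
    have h := Real.add_one_le_exp (t * l ^ α)
    have h' : Real.exp (t * l ^ α) * e = 1 := by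
      rw [he, ← Real.exp_add]; simp
    nlinarith
  have ha : α * (1 - α) ≤ 1 := by nlinarith
  have hb : α * α ≤ 1 := by nlinarith
  have ha0 : 0 ≤ α * (1 - α) := by nlinarith
  have f1 : t * (α * (1 - α)) * l ^ (α - 2) * ‖c‖ * e ≤ t * 1 * l ^ (α - 2) * ‖c‖ * 1 := by
    gcongr
  have f2 : t * α * l ^ (α - 1) * ‖c‖ * (t * α * ‖c‖ * (l ^ (α - 1) * e))
      = t * (α * α) * ‖c‖ ^ 2 * l ^ (α - 2) * ((t * l ^ α) * e) := by
    linear_combination (t * α * ‖c‖ * t * α * ‖c‖ * e) * e2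
  have f3 : t * (α * α) * ‖c‖ ^ 2 * l ^ (α - 2) * ((t * l ^ α) * e)
      ≤ t * 1 * ‖c‖ ^ 2 * l ^ (α - 2) * 1 := by
    gcongr
  rw [f2]
  linarith

lemma GG_int {α t x : ℝ} {c : ℂ} (hα : 0 < α) (ht : 0 < t) (hc : c.re = 1) :
    IntegrableOn (GG α t x c) (Ioi 0) := by
  have h := integrableOn_rpow_mul_exp_neg_mul_rpow (p := α) (s := 0) (b := t) (by norm_num) hα ht
  refine Integrable.mono' h (GG_cont hα).aestronglyMeasurable ?_
  refine Eventually.of_forall fun l => ?_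
  rw [GG_norm hc]; simp

lemma KK_meas {α t x : ℝ} {c : ℂ} (hα : 0 < α) : Measurable (KK α t x c) := by
  have := (GG_cont (t := t) (x := x) (c := c) hα).measurable
  unfold KK
  fun_prop

lemma RR_meas {α t x : ℝ} {c : ℂ} (hα : 0 < α) : Measurable (RR α t x c) := by
  have := (GG_cont (t := t) (x := x) (c := c) hα).measurable
  have := (KK_meas (t := t) (x := x) (c := c) hα)
  unfold RR
  fun_prop

lemma KK_int {α t x : ℝ} {c : ℂ} (hα : 0 < α) (ht : 0 < t) (hc : c.re = 1) :
    IntegrableOn (KK α t x c) (Ioi 0) := by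
  have h := integrableOn_rpow_mul_exp_neg_mul_rpow (p := α) (s := α - 1) (b := t)
    (by linarith) hα ht
  refine Integrable.mono' (h.const_mul (t * α * ‖c‖)) (KK_meas hα).aestronglyMeasurable ?_
  filter_upwards [ae_restrict_mem measurableSet_Ioi] with l hl
  exact (KK_norm hα ht hc hl).le

lemma RR_int {α t x h : ℝ} {c : ℂ} (hα : 0 < α) (hα1 : α < 1) (ht : 0 < t) (hc : c.re = 1)
    (hh : 0 < h) : IntegrableOn (RR α t x c) (Ioi h) := by
  have hi := integrableOn_Ioi_rpow_of_lt (a := α - 2) (c := h) (by linarith) hh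
  refine Integrable.mono' (hi.const_mul (t * (‖c‖ + ‖c‖ ^ 2)))
    (RR_meas hα).aestronglyMeasurable ?_
  filter_upwards [ae_restrict_mem measurableSet_Ioi] with l hl
  exact RR_le hα hα1 ht hc (hh.trans hl)

lemma RR_integral_le {α t x h : ℝ} {c : ℂ} (hα : 0 < α) (hα1 : α < 1) (ht : 0 < t)
    (hc : c.re = 1) (hh : 0 < h) :
    ‖∫ l in Ioi h, RR α t x c l‖ ≤ t * (‖c‖ + ‖c‖ ^ 2) * (h ^ (α - 1) / (1 - α)) := by
  have hi := integrableOn_Ioi_rpow_of_lt (a := α - 2) (c := h) (by linarith) hh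
  have := norm_integral_le_of_norm_le (μ := volume.restrict (Ioi h)) (f := RR α t x c)
    (hi.const_mul (t * (‖c‖ + ‖c‖ ^ 2))) (by
      filter_upwards [ae_restrict_mem measurableSet_Ioi] with l hl
      exact RR_le hα hα1 ht hc (hh.trans hl))
  rw [integral_const_mul, integral_Ioi_rpow_of_lt (by linarith) hh] at this
  convert this using 2
  rw [show α - 2 + 1 = α - 1 by ring, show 1 - α = -(α - 1) by ring, div_neg, neg_div]

lemma KK_small {α t x h : ℝ} {c : ℂ} (hα : 0 < α) (ht : 0 < t)
    (hc : c.re = 1) (hh : 0 < h) :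
    ‖∫ l in Ioc 0 h, KK α t x c l‖ ≤ t * ‖c‖ * h ^ α := by
  have hi : IntervalIntegrable (fun l : ℝ => l ^ (α - 1)) volume 0 h :=
    intervalIntegral.intervalIntegrable_rpow' (by linarith)
  rw [← intervalIntegral.integral_of_le hh.le]
  have := intervalIntegral.norm_integral_le_of_norm_le (f := KK α t x c) hh.le
    (Eventually.of_forall fun l hl => KK_le (x := x) hα ht hc hl.1)
    (hi.const_mul (t * α * ‖c‖))
  refine this.trans (le_of_eq ?_)
  rw [intervalIntegral.integral_const_mul, integral_rpow (Or.inl (by linarith))]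
  rw [show α - 1 + 1 = α by ring, Real.zero_rpow hα.ne']
  field_simp
  ring

lemma KK_large {α t x : ℝ} {c : ℂ} (hα : 0 < α) (hα1 : α < 1) (ht : 0 < t)
    (hc : c.re = 1) (hx : x ≠ 0) :
    ‖∫ l in Ioi |x|⁻¹, KK α t x c l‖ ≤
      t * ((‖c‖ + ‖c‖ ^ 2) / (1 - α) + ‖c‖) * |x|⁻¹ ^ α := by
  set h := |x|⁻¹ with hhdef
  have hax : 0 < |x| := abs_pos.2 hx
  have hh : 0 < h := by positivity
  have hKi : IntegrableOn (KK α t x c) (Ioi h) :=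
    (KK_int hα ht hc).mono_set (Ioi_subset_Ioi hh.le)
  have hRi := RR_int (x := x) hα hα1 ht hc hh
  have hlim : Tendsto (KK α t x c) atTop (𝓝 0) := by
    rw [tendsto_zero_iff_norm_tendsto_zero]
    have h0 : Tendsto (fun l : ℝ => t * α * ‖c‖ * l ^ (α - 1)) atTop (𝓝 (t * α * ‖c‖ * 0)) := by
      have := tendsto_rpow_neg_atTop (y := 1 - α) (by linarith)
      rw [show -(1 - α) = α - 1 by ring] at this
      exact this.const_mul _
    rw [mul_zero] at h0
    refine tendsto_of_tendsto_of_tendsto_of_le_of_le' tendsto_const_nhds h0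
      (Eventually.of_forall fun _ => norm_nonneg _) ?_
    filter_upwards [eventually_gt_atTop 0] with l hl
    exact KK_le hα ht hc hl
  have hmain := integral_Ioi_of_hasDerivAt_of_tendsto' (a := h)
    (fun l hl => KK_deriv (α := α) (t := t) (x := x) (c := c) (hh.trans_le hl))
    ((hKi.const_mul _).add hRi) hlim
  have hadd := integral_add (hKi.const_mul (-(Complex.I * x))) hRi
  rw [hadd, integral_const_mul] at hmain
  set K := ∫ l in Ioi h, KK α t x c l
  set R := ∫ l in Ioi h, RR α t x c l with hR
  have e1 : (Complex.I * x) * K = KK α t x c h + R := by linear_combination -hmain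
  have e2 : |x| * ‖K‖ ≤ ‖KK α t x c h‖ + ‖R‖ := by
    calc |x| * ‖K‖ = ‖(Complex.I * x) * K‖ := by simp
      _ ≤ _ := by rw [e1]; exact norm_add_le _ _
  have e3 := KK_le (x := x) hα ht hc hh
  have e4 := RR_integral_le (x := x) hα hα1 ht hc hh
  have e5 : h * h ^ (α - 1) = h ^ α := by
    rw [← Real.rpow_one_add' hh.le (by linarith)]; congr 1; ring
  have e6 : ‖K‖ = h * (|x| * ‖K‖) := by
    rw [hhdef]; field_simp
  have e7 : t * α * ‖c‖ * h ^ (α - 1) ≤ t * 1 * ‖c‖ * h ^ (α - 1) := by gcongr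
  rw [e6]
  calc h * (|x| * ‖K‖) ≤ h * (t * 1 * ‖c‖ * h ^ (α - 1) +
        t * (‖c‖ + ‖c‖ ^ 2) * (h ^ (α - 1) / (1 - α))) := by
        gcongr; linarith
    _ = t * ((‖c‖ + ‖c‖ ^ 2) / (1 - α) + ‖c‖) * (h * h ^ (α - 1)) := by
        ring
    _ = _ := by rw [e5]

lemma GG_re_le {α t x : ℝ} {c : ℂ} (hα : 0 < α) (hα1 : α < 1) (ht : 0 < t)
    (hc : c.re = 1) (hx : x ≠ 0) :
    (∫ l in Ioi 0, GG α t x c l).re ≤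
      ((‖c‖ + ‖c‖ ^ 2) / (1 - α) + 2 * ‖c‖) * t / |x| ^ (α + 1) := by
  have hax : 0 < |x| := abs_pos.2 hx
  have hlim : Tendsto (GG α t x c) atTop (𝓝 0) := by
    rw [tendsto_zero_iff_norm_tendsto_zero]
    simp_rw [GG_norm hc, neg_mul]
    exact Real.tendsto_exp_neg_atTop_nhds_zero.comp
      ((tendsto_rpow_atTop hα).const_mul_atTop ht)
  have hGi := GG_int (x := x) hα ht hc
  have hKi := KK_int (x := x) hα ht hc
  have hmain := integral_Ioi_of_hasDerivAt_of_tendsto (a := 0)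
    (GG_cont hα).continuousAt.continuousWithinAt
    (fun l hl => GG_deriv (α := α) (t := t) (x := x) (c := c) hl)
    ((hGi.const_mul _).sub hKi) hlim
  have hsub := integral_sub (hGi.const_mul (-(Complex.I * x))) hKi
  have h0 : GG α t x c 0 = 1 := by simp [GG, Real.zero_rpow hα.ne']
  have hmain2 : (∫ l in Ioi 0, -(Complex.I * x) * GG α t x c l - KK α t x c l) = 0 - 1 := by
    rw [← h0]; exact hmain
  rw [hsub, integral_const_mul] at hmain2
  have hsplit : ∫ l in Ioi 0, KK α t x c l =
      (∫ l in Ioc 0 |x|⁻¹, KK α t x c l) + ∫ l in Ioi |x|⁻¹, KK α t x c l := by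
    rw [← setIntegral_union (Ioc_disjoint_Ioi le_rfl) measurableSet_Ioi
      (hKi.mono_set Ioc_subset_Ioi_self) (hKi.mono_set (Ioi_subset_Ioi (by positivity))),
      Ioc_union_Ioi_eq_Ioi (by positivity)]
  have hs := KK_small (x := x) (h := |x|⁻¹) hα ht hc (by positivity)
  have hl := KK_large hα hα1 ht hc hx
  set J := ∫ l in Ioi 0, GG α t x c l
  set K := ∫ l in Ioi 0, KK α t x c l
  have hK : ‖K‖ ≤ t * ((‖c‖ + ‖c‖ ^ 2) / (1 - α) + 2 * ‖c‖) * |x|⁻¹ ^ α := by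
    rw [hsplit]
    refine (norm_add_le _ _).trans ((add_le_add hs hl).trans (le_of_eq (by ring)))
  have him := congrArg Complex.im hmain2
  simp at him
  have h3 : |x * J.re| ≤ ‖K‖ := by
    rw [show x * J.re = - K.im by linarith, abs_neg]
    exact Complex.abs_im_le_norm K
  rw [abs_mul] at h3
  have h4 : J.re ≤ |x|⁻¹ * ‖K‖ := by
    rw [inv_mul_eq_div, le_div_iff₀ hax]
    nlinarith [le_abs_self J.re]
  refine h4.trans ((mul_le_mul_of_nonneg_left hK (by positivity)).trans (le_of_eq ?_))
  rw [Real.rpow_add hax, Real.rpow_one, Real.inv_rpow hax.le]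
  field_simp

lemma GG_re_le_one {t x : ℝ} (ht : 0 < t) (hx : x ≠ 0) :
    (∫ l in Ioi 0, GG 1 t x 1 l).re ≤ 1 * t / |x| ^ ((1:ℝ) + 1) := by
  have h := integral_exp_mul_complex_Ioi (a := -(t + Complex.I * x)) (by simpa using ht) 0
  have e : ∫ l in Ioi (0:ℝ), GG 1 t x 1 l = ∫ l : ℝ in Ioi 0, Complex.exp (-(t + Complex.I * x) * l) := by
    congr 1; ext l; unfold GG; congr 1; simp; ring
  rw [e, h]
  have hx2 : 0 < x ^ 2 := by positivity
  have hq : |x| ^ ((1:ℝ) + 1) = x ^ 2 := by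
    rw [show (1:ℝ) + 1 = (2:ℕ) by norm_num, Real.rpow_natCast, sq_abs]
  rw [hq]
  simp [Complex.div_re, Complex.normSq_apply]
  rw [div_le_div_iff₀ (by nlinarith) hx2]
  nlinarith [mul_pos ht (mul_pos ht ht)]

lemma GG_re_le_t {α t x : ℝ} {c : ℂ} (hα : 0 < α) (ht : 0 < t) (hc : c.re = 1) :
    (∫ l in Ioi 0, GG α t x c l).re ≤ Real.Gamma (1 / α + 1) * t ^ (-1 / α) := by
  refine (Complex.re_le_norm _).trans ((norm_integral_le_integral_norm _).trans (le_of_eq ?_))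
  simp_rw [GG_norm hc]
  rw [integral_exp_neg_mul_rpow hα ht, mul_comm]

lemma combine {α t x P A B : ℝ} (hα : 0 < α) (ht : 0 < t) (hA : 0 ≤ A) (hB : 0 ≤ B)
    (h1 : P ≤ A * t ^ (-1 / α)) (h2 : x ≠ 0 → P ≤ B * t / |x| ^ (α + 1)) :
    P ≤ (2 ^ (α + 1) * (A + B)) * t / (t ^ (1 / α) + |x|) ^ (α + 1) := by
  have hs : 0 < t ^ (1 / α) := Real.rpow_pos_of_pos ht _
  have h2p : (0:ℝ) < 2 ^ (α + 1) := by positivity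
  have key : ∀ m D : ℝ, 0 < m → 0 ≤ D → D ≤ A + B → t ^ (1 / α) + |x| ≤ 2 * m →
      P ≤ D * t / m ^ (α + 1) →
      P ≤ (2 ^ (α + 1) * (A + B)) * t / (t ^ (1 / α) + |x|) ^ (α + 1) := by
    intro m D hm hD hDA hle hP
    refine hP.trans ?_
    have hS : 0 < t ^ (1 / α) + |x| := by positivity
    have e : D * t / m ^ (α + 1) = (2 ^ (α + 1) * D) * t / (2 * m) ^ (α + 1) := by
      rw [Real.mul_rpow (by norm_num) hm.le]
      field_simp
    rw [e]
    gcongr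
  rcases le_total |x| (t ^ (1 / α)) with h | h
  · refine key (t ^ (1 / α)) A hs hA (by linarith) (by linarith) (h1.trans (le_of_eq ?_))
    rw [mul_div_assoc]
    congr 1
    rw [← Real.rpow_mul ht.le]
    nth_rewrite 2 [← Real.rpow_one t]
    rw [← Real.rpow_sub ht]
    congr 1
    field_simp
    ring
  · have hx : 0 < |x| := hs.trans_le h
    exact key |x| B hx hB (by linarith) (by linarith) (h2 (abs_pos.1 hx))

def HH (α δ t x l : ℝ) : ℂ := Complex.exp (-(Complex.I * l * x)) * stableCF α δ t l

def cc (α δ : ℝ) : ℂ := 1 - Complex.I * (δ : ℂ) * ((Real.tan (π * α / 2) : ℝ) : ℂ)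

lemma cc_re (α δ : ℝ) : (cc α δ).re = 1 := by
  unfold cc
  rw [Complex.sub_re, mul_assoc, ← Complex.ofReal_mul, Complex.I_mul_re, Complex.ofReal_im]
  simp

lemma cc_one : cc 1 0 = 1 := by simp [cc]

lemma HH_pos {α δ t x l : ℝ} (h1 : α = 1 → δ = 0) (hl : 0 < l) :
    HH α δ t x l = GG α t x (cc α δ) l := by
  unfold HH GG stableCF
  split_ifs with h
  · rw [h1 h, h, cc_one, ← Complex.exp_add, abs_of_pos hl]
    congr 1
    simp
    ring
  · rw [← Complex.exp_add, abs_of_pos hl, Real.sign_of_pos hl]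
    congr 1
    unfold cc
    push_cast
    ring

lemma HH_neg {α δ t x l : ℝ} : HH α δ t x (-l) = (starRingEnd ℂ) (HH α δ t x l) := by
  unfold HH stableCF
  split_ifs with h
  · rw [map_mul, ← Complex.exp_conj, ← Complex.exp_conj]
    simp
  · rw [map_mul, ← Complex.exp_conj, ← Complex.exp_conj, Real.sign_neg]
    simp [-Complex.ofReal_tan]

lemma HH_intIoi {α δ t x : ℝ} (hα : 0 < α) (ht : 0 < t) (h1 : α = 1 → δ = 0) :
    IntegrableOn (HH α δ t x) (Ioi 0) :=
  (GG_int (x := x) hα ht (cc_re α δ)).congr_fun (fun _ hl => (HH_pos h1 hl).symm) measurableSet_Ioi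

lemma HH_intIic {α δ t x : ℝ} (hα : 0 < α) (ht : 0 < t) (h1 : α = 1 → δ = 0) :
    IntegrableOn (HH α δ t x) (Iic 0) := by
  rw [integrableOn_Iic_iff_integrableOn_Iio,
    ← (Measure.measurePreserving_neg (volume : Measure ℝ)).integrableOn_comp_preimage
      (Homeomorph.neg ℝ).measurableEmbedding]
  have : (HH α δ t x ∘ Neg.neg) = fun l => (Complex.conjCLE : ℂ →L[ℝ] ℂ) (HH α δ t x l) := by
    ext l; simp [HH_neg]
  rw [this]
  simp only [neg_preimage, neg_Iio, neg_zero]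
  exact ContinuousLinearMap.integrable_comp _ (HH_intIoi hα ht h1)

lemma HH_int {α δ t x : ℝ} (hα : 0 < α) (ht : 0 < t) (h1 : α = 1 → δ = 0) :
    Integrable (HH α δ t x) := by
  rw [← integrableOn_univ, ← Iic_union_Ioi (a := (0:ℝ)), integrableOn_union]
  exact ⟨HH_intIic hα ht h1, HH_intIoi hα ht h1⟩

lemma HH_integral {α δ t x : ℝ} (hα : 0 < α) (ht : 0 < t) (h1 : α = 1 → δ = 0) :
    (∫ l, HH α δ t x l).re = 2 * (∫ l in Ioi 0, GG α t x (cc α δ) l).re := by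
  rw [← intervalIntegral.integral_Iic_add_Ioi (HH_intIic hα ht h1) (HH_intIoi hα ht h1)]
  have e1 : ∫ l in Ioi 0, HH α δ t x l = ∫ l in Ioi 0, GG α t x (cc α δ) l :=
    setIntegral_congr_fun measurableSet_Ioi fun _ hl => HH_pos h1 hl
  have e2 : ∫ l in Iic 0, HH α δ t x l = (starRingEnd ℂ) (∫ l in Ioi 0, HH α δ t x l) := by
    have := integral_comp_neg_Ioi 0 (HH α δ t x)
    rw [neg_zero] at this
    rw [← this, ← integral_conj]
    simp_rw [HH_neg]
  rw [e2, e1, Complex.add_re, Complex.conj_re]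
  ring

lemma inversion {α δ t : ℝ} (hα : 0 < α) (ht : 0 < t) (h1 : α = 1 → δ = 0)
    (q : ℝ → ℝ) (hq : Continuous q)
    (hcf : ∀ l : ℝ, (∫ x : ℝ, Complex.exp (Complex.I * (l : ℂ) * (x : ℂ)) * ((q x : ℝ) : ℂ))
        = stableCF α δ t l) (x : ℝ) :
    q x = π⁻¹ * (∫ l in Ioi 0, GG α t x (cc α δ) l).re := by
  set P : ℝ → ℂ := fun x => (q x : ℂ)
  have hPc : Continuous P := by fun_prop
  have hPi : Integrable P := by
    by_contra hn
    have h0 := hcf 0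
    have : stableCF α δ t 0 = 1 := by
      unfold stableCF; split_ifs <;> simp [Real.zero_rpow hα.ne']
    rw [this] at h0
    simp only [Complex.ofReal_zero, mul_zero, zero_mul, Complex.exp_zero, one_mul] at h0
    rw [integral_undef hn] at h0
    exact zero_ne_one h0
  have hF : FourierTransform.fourier P = fun w => stableCF α δ t (-(2 * π) * w) := by
    ext w
    rw [Real.fourier_real_eq_integral_exp_smul, ← hcf]
    congr 1; ext v
    rw [smul_eq_mul]
    congr 2
    push_cast; ring
  have h2pi : -(2 * π) ≠ 0 := by have := Real.pi_pos; linarith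
  have hFi : Integrable (FourierTransform.fourier P) := by
    rw [hF]
    have h := (HH_int (x := 0) hα ht h1).comp_mul_left' h2pi
    simpa [HH] using h
  have hinv := hPi.fourierInv_fourier_eq hFi (v := x) hPc.continuousAt
  rw [Real.fourierInv_eq_fourier_neg, Real.fourier_real_eq_integral_exp_smul, hF] at hinv
  have e : (∫ v : ℝ, Complex.exp (↑(-2 * π * v * -x) * Complex.I) • stableCF α δ t (-(2 * π) * v))
      = ∫ v : ℝ, HH α δ t x (-(2 * π) * v) := by
    congr 1; ext v
    unfold HH
    rw [smul_eq_mul]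
    congr 2
    push_cast; ring
  rw [e, Measure.integral_comp_mul_left] at hinv
  have hre := congrArg Complex.re hinv
  rw [Complex.real_smul, Complex.re_ofReal_mul, HH_integral hα ht h1] at hre
  have : (P x).re = q x := rfl
  rw [← this, ← hre, inv_neg, abs_neg, abs_of_pos (by positivity)]
  have := Real.pi_pos
  field_simp

/-- Lemma 2.1 (1): two-sided stable density estimate `p_t(x) ≤ C_α t/(t^{1/α}+|x|)^{α+1}`. -/
theorem stable_density_upper_bound
    (α δ : ℝ) (hα0 : 0 < α) (hα1 : α ≤ 1) (hδ : δ ∈ Set.Ioo (-1 : ℝ) 1)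
    (h1 : α = 1 → δ = 0)
    (p : ℝ → ℝ → ℝ)
    (hp : ∀ t : ℝ, 0 < t → (∀ x, 0 ≤ p t x) ∧ Continuous (p t) ∧
      ∀ l : ℝ, (∫ x : ℝ, Complex.exp (Complex.I * (l : ℂ) * (x : ℂ)) * ((p t x : ℝ) : ℂ))
        = stableCF α δ t l) :
    ∃ C > 0, ∀ t : ℝ, 0 < t → ∀ x : ℝ,
      p t x ≤ C * t / (t ^ (1/α) + |x|) ^ (α + 1) := by
  obtain ⟨B, hB0, hB⟩ : ∃ B : ℝ, 0 ≤ B ∧ ∀ t : ℝ, 0 < t → ∀ x : ℝ, x ≠ 0 →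
      (∫ l in Ioi 0, GG α t x (cc α δ) l).re ≤ B * t / |x| ^ (α + 1) := by
    rcases hα1.lt_or_eq with h | h
    · refine ⟨(‖cc α δ‖ + ‖cc α δ‖ ^ 2) / (1 - α) + 2 * ‖cc α δ‖, ?_, fun t ht x hx =>
        GG_re_le hα0 h ht (cc_re α δ) hx⟩
      have : 0 < 1 - α := by linarith
      positivity
    · have hδ0 := h1 h
      subst h
      subst hδ0
      rw [cc_one]
      exact ⟨1, zero_le_one, fun t ht x hx => GG_re_le_one ht hx⟩
  have hG : 0 < Real.Gamma (1 / α + 1) := Real.Gamma_pos_of_pos (by positivity)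
  have hπ : 0 < π⁻¹ := inv_pos.2 Real.pi_pos
  refine ⟨2 ^ (α + 1) * (π⁻¹ * Real.Gamma (1 / α + 1) + π⁻¹ * B), by positivity, ?_⟩
  intro t ht x
  obtain ⟨-, hc, hcf⟩ := hp t ht
  have hinv := inversion hα0 ht h1 (p t) hc hcf x
  refine combine hα0 ht (by positivity) (by positivity) ?_ ?_
  · rw [hinv, mul_assoc]
    exact mul_le_mul_of_nonneg_left (GG_re_le_t hα0 ht (cc_re α δ)) hπ.le
  · intro hx
    rw [hinv, mul_assoc, mul_div_assoc]
    exact mul_le_mul_of_nonneg_left (hB t ht x hx) hπ.le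
end
end

section
/- Let α ∈ (0,1], δ ∈ (-1,1) (with δ = 0 if α = 1), and let p_t be the density of the α-stable law with characteristic function λ ↦ exp(−t|λ|^α(1 − iδ sign(λ) tan(πα/2))) (exp(−t|λ|) when α = 1). Then there is a constant C_α > 0 such that for all t > 0 and x ∈ ℝ, |L^{α,δ} p_t(x)| ≤ C_α / (t^{1/α} + |x|)^{α+1}, where L^{α,δ} acts on the variable x. -/
open MeasureTheory Real Filter Set
open scoped Topology

noncomputable section
/-- The oscillatory integrand. -/
def gfun (α : ℝ) (c : ℂ) (s : ℝ) : ℂ := ((s ^ α : ℝ) : ℂ) * Complex.exp (-(c * ((s ^ α : ℝ) : ℂ)))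

lemma norm_cexp_neg (c : ℂ) (hc : c.re = 1) (m : ℝ) :
    ‖Complex.exp (-(c * (m : ℂ)))‖ = Real.exp (-m) := by
  rw [Complex.norm_exp]
  simp [hc]

lemma poly_exp_le (m : ℝ) (hm : 0 ≤ m) : (1 + m + m ^ 2) * Real.exp (-m) ≤ 2 := by
  have h := Real.quadratic_le_exp_of_nonneg hm
  rw [Real.exp_neg, ← div_eq_mul_inv, div_le_iff₀ (Real.exp_pos m)]
  nlinarith

lemma norm_gfun (α : ℝ) (c : ℂ) (hc : c.re = 1) (s : ℝ) (hs : 0 ≤ s) :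
    ‖gfun α c s‖ = s ^ α * Real.exp (-s ^ α) := by
  rw [gfun, norm_mul, norm_cexp_neg c hc, Complex.norm_real, Real.norm_of_nonneg (Real.rpow_nonneg hs α)]

def gfun1 (α : ℝ) (c : ℂ) (s : ℝ) : ℂ :=
  ((α * s ^ (α - 1) : ℝ) : ℂ) * (1 - c * ((s ^ α : ℝ) : ℂ)) * Complex.exp (-(c * ((s ^ α : ℝ) : ℂ)))

def gfun2 (α : ℝ) (c : ℂ) (s : ℝ) : ℂ :=
  ((α * s ^ (α - 2) : ℝ) : ℂ) * ((α - 1) * (1 - c * ((s ^ α : ℝ) : ℂ)) - c * α * ((s ^ α : ℝ) : ℂ)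
    - (1 - c * ((s ^ α : ℝ) : ℂ)) * c * α * ((s ^ α : ℝ) : ℂ)) * Complex.exp (-(c * ((s ^ α : ℝ) : ℂ)))

lemma hasDerivAt_gfun (α : ℝ) (c : ℂ) (s : ℝ) (hs : 0 < s) :
    HasDerivAt (gfun α c) (gfun1 α c s) s := by
  have h1 : HasDerivAt (fun s : ℝ => ((s ^ α : ℝ) : ℂ)) ((α * s ^ (α - 1) : ℝ) : ℂ) s :=
    (Real.hasDerivAt_rpow_const (Or.inl hs.ne')).ofReal_comp
  have h2 := ((h1.const_mul c).neg).cexp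
  refine (h1.mul h2).congr_deriv ?_
  simp only [gfun1, Pi.neg_apply]
  ring

lemma hasDerivAt_gfun1 (α : ℝ) (c : ℂ) (s : ℝ) (hs : 0 < s) :
    HasDerivAt (gfun1 α c) (gfun2 α c s) s := by
  have h1 : HasDerivAt (fun s : ℝ => ((s ^ α : ℝ) : ℂ)) ((α * s ^ (α - 1) : ℝ) : ℂ) s :=
    (Real.hasDerivAt_rpow_const (Or.inl hs.ne')).ofReal_comp
  have h0 : HasDerivAt (fun s : ℝ => ((α * s ^ (α - 1) : ℝ) : ℂ))
      ((α * ((α - 1) * s ^ (α - 1 - 1)) : ℝ) : ℂ) s :=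
    ((Real.hasDerivAt_rpow_const (Or.inl hs.ne')).const_mul α).ofReal_comp
  have h2 := ((h1.const_mul c).neg).cexp
  refine ((h0.mul ((h1.const_mul c).const_sub 1)).mul h2).congr_deriv ?_
  have e1 : s ^ (α - 1 - 1) = s ^ (α - 2) := by congr 1; ring
  have e2 : s ^ (α - 1) * s ^ (α - 1) = s ^ (α - 2) * s ^ α := by
    rw [← Real.rpow_add hs, ← Real.rpow_add hs]; congr 1; ring
  have e2' : ((s ^ (α - 1) : ℝ) : ℂ) * ((s ^ (α - 1) : ℝ) : ℂ)
      = ((s ^ (α - 2) : ℝ) : ℂ) * ((s ^ α : ℝ) : ℂ) := by exact_mod_cast e2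
  simp only [gfun2, Pi.neg_apply, Pi.mul_apply, e1]
  push_cast
  generalize ((s ^ (α - 1) : ℝ) : ℂ) = A at *
  generalize ((s ^ (α - 2) : ℝ) : ℂ) = B at *
  generalize ((s ^ α : ℝ) : ℂ) = M at *
  generalize Complex.exp (-(c * M)) = E at *
  linear_combination (-(α : ℂ) ^ 2 * c * E * (2 - c * M)) * e2'

lemma norm_gfun1_le (α : ℝ) (hα0 : 0 < α) (hα1 : α ≤ 1) (c : ℂ) (hc : c.re = 1) (s : ℝ) (hs : 0 < s) :
    ‖gfun1 α c s‖ ≤ 2 * (1 + ‖c‖) * s ^ (α - 1) := by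
  have hm : 0 < s ^ α := Real.rpow_pos_of_pos hs α
  have hA : 0 < s ^ (α - 1) := Real.rpow_pos_of_pos hs _
  rw [gfun1, norm_mul, norm_mul, norm_cexp_neg c hc, Complex.norm_real,
    Real.norm_of_nonneg (by positivity)]
  set m := s ^ α
  have h1 : ‖1 - c * (m : ℂ)‖ ≤ (1 + ‖c‖) * (1 + m + m ^ 2) := by
    calc ‖1 - c * (m : ℂ)‖ ≤ ‖(1 : ℂ)‖ + ‖c * (m : ℂ)‖ := norm_sub_le _ _
      _ = 1 + ‖c‖ * m := by rw [norm_mul, Complex.norm_real, Real.norm_of_nonneg hm.le]; simp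
      _ ≤ _ := by nlinarith [norm_nonneg c, mul_nonneg (norm_nonneg c) (sq_nonneg m), sq_nonneg m]
  have h2 := poly_exp_le m hm.le
  calc α * s ^ (α - 1) * ‖1 - c * (m : ℂ)‖ * Real.exp (-m)
      ≤ 1 * s ^ (α - 1) * ((1 + ‖c‖) * (1 + m + m ^ 2)) * Real.exp (-m) := by gcongr
    _ = s ^ (α - 1) * (1 + ‖c‖) * ((1 + m + m ^ 2) * Real.exp (-m)) := by ring
    _ ≤ s ^ (α - 1) * (1 + ‖c‖) * 2 := by gcongr
    _ = _ := by ring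

lemma norm_gfun2_le (α : ℝ) (hα0 : 0 < α) (hα1 : α ≤ 1) (c : ℂ) (hc : c.re = 1) (s : ℝ) (hs : 0 < s) :
    ‖gfun2 α c s‖ ≤ 6 * (1 + ‖c‖) ^ 2 * s ^ (α - 2) := by
  have hm : 0 < s ^ α := Real.rpow_pos_of_pos hs α
  have hA : 0 < s ^ (α - 2) := Real.rpow_pos_of_pos hs _
  rw [gfun2, norm_mul, norm_mul, norm_cexp_neg c hc, Complex.norm_real,
    Real.norm_of_nonneg (by positivity)]
  set m := s ^ α
  have hcn := norm_nonneg c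
  have h0 : ‖1 - c * (m : ℂ)‖ ≤ 1 + ‖c‖ * m := by
    calc ‖1 - c * (m : ℂ)‖ ≤ ‖(1 : ℂ)‖ + ‖c * (m : ℂ)‖ := norm_sub_le _ _
      _ = 1 + ‖c‖ * m := by rw [norm_mul, Complex.norm_real, Real.norm_of_nonneg hm.le]; simp
  have ha : ‖(α : ℂ) - 1‖ ≤ 1 := by
    rw [← Complex.ofReal_one, ← Complex.ofReal_sub, Complex.norm_real, Real.norm_eq_abs, abs_le]
    constructor <;> linarith
  have ha' : ‖(α : ℂ)‖ ≤ 1 := by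
    rw [Complex.norm_real, Real.norm_eq_abs, abs_le]
    constructor <;> linarith
  have hm' : ‖(m : ℂ)‖ = m := by rw [Complex.norm_real, Real.norm_of_nonneg hm.le]
  have h1 : ‖((α : ℂ) - 1) * (1 - c * (m : ℂ)) - c * α * (m : ℂ) - (1 - c * (m : ℂ)) * c * α * (m : ℂ)‖
      ≤ 3 * (1 + ‖c‖) ^ 2 * (1 + m + m ^ 2) := by
    calc _ ≤ ‖((α : ℂ) - 1) * (1 - c * (m : ℂ))‖ + ‖c * α * (m : ℂ)‖
            + ‖(1 - c * (m : ℂ)) * c * α * (m : ℂ)‖ :=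
          (norm_sub_le _ _).trans (by gcongr; exact norm_sub_le _ _)
      _ ≤ 1 * (1 + ‖c‖ * m) + ‖c‖ * 1 * m + (1 + ‖c‖ * m) * ‖c‖ * 1 * m := by
          simp only [norm_mul, hm']
          gcongr
      _ ≤ _ := by
          have : 0 ≤ ‖c‖ * m := by positivity
          have : 0 ≤ ‖c‖ * m ^ 2 := by positivity
          have : 0 ≤ ‖c‖ ^ 2 * m ^ 2 := by positivity
          have : 0 ≤ ‖c‖ ^ 2 * m := by positivity
          nlinarith
  have h2 := poly_exp_le m hm.le
  calc _ ≤ 1 * s ^ (α - 2) * (3 * (1 + ‖c‖) ^ 2 * (1 + m + m ^ 2)) * Real.exp (-m) := by gcongr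
    _ = s ^ (α - 2) * (3 * (1 + ‖c‖) ^ 2) * ((1 + m + m ^ 2) * Real.exp (-m)) := by ring
    _ ≤ s ^ (α - 2) * (3 * (1 + ‖c‖) ^ 2) * 2 := by gcongr
    _ = _ := by ring

lemma measurable_gfun (α : ℝ) (c : ℂ) : Measurable (gfun α c) := by
  unfold gfun; fun_prop

lemma measurable_gfun2 (α : ℝ) (c : ℂ) : Measurable (gfun2 α c) := by
  unfold gfun2; fun_prop

lemma integrableOn_gfun (α : ℝ) (hα0 : 0 < α) (c : ℂ) (hc : c.re = 1) :
    IntegrableOn (gfun α c) (Ioi 0) := by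
  have h := integrableOn_rpow_mul_exp_neg_rpow (p := α) (s := α) (by linarith) hα0
  refine Integrable.mono' h (measurable_gfun α c).aestronglyMeasurable ?_
  filter_upwards [ae_restrict_mem measurableSet_Ioi] with s hs
  exact (norm_gfun α c hc s (le_of_lt hs)).le

def eix (y s : ℝ) : ℂ := Complex.exp (Complex.I * (y : ℂ) * (s : ℂ))

lemma norm_eix (y s : ℝ) : ‖eix y s‖ = 1 := by
  rw [eix, Complex.norm_exp]; simp

lemma continuous_eix (y : ℝ) : Continuous (eix y) := by
  unfold eix; fun_prop

lemma integrableOn_eix_mul {S : Set ℝ} (y : ℝ) {f : ℝ → ℂ} (hf : IntegrableOn f S) :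
    IntegrableOn (fun s => eix y s * f s) S := by
  refine Integrable.mono hf ((continuous_eix y).aestronglyMeasurable.mul hf.aestronglyMeasurable) ?_
  filter_upwards with s
  simp [norm_eix]

lemma decay_lt_aux (α : ℝ) (hα0 : 0 < α) (hα1 : α < 1) (c : ℂ) (hc : c.re = 1) (y : ℝ) (hy : y ≠ 0) :
    ‖∫ s in Ioi (0:ℝ), eix y s * gfun α c s‖
      ≤ (2 + 2 * (1 + ‖c‖) + 6 * (1 + ‖c‖) ^ 2 / (1 - α)) * |y| ^ (-1 - α) := by
  set a : ℝ := |y|⁻¹ with ha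
  have hy0 : 0 < |y| := abs_pos.mpr hy
  have ha0 : 0 < a := inv_pos.mpr hy0
  have hg := integrableOn_gfun α hα0 c hc
  have hge := integrableOn_eix_mul y hg
  have hsplit : ∫ s in Ioi (0:ℝ), eix y s * gfun α c s
      = (∫ s in Ioc 0 a, eix y s * gfun α c s) + ∫ s in Ioi a, eix y s * gfun α c s := by
    rw [← setIntegral_union (Ioc_disjoint_Ioi le_rfl) measurableSet_Ioi
      (hge.mono_set Ioc_subset_Ioi_self) (hge.mono_set (Ioi_subset_Ioi ha0.le)),
      Ioc_union_Ioi_eq_Ioi ha0.le]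
  have hpa : a ^ α * a = |y| ^ (-1 - α) := by
    rw [← Real.rpow_add_one ha0.ne', ha, Real.inv_rpow hy0.le, ← Real.rpow_neg hy0.le]; congr 1; ring
  have hgle : ∀ s, 0 ≤ s → ‖gfun α c s‖ ≤ s ^ α := by
    intro s hs
    rw [norm_gfun α c hc s hs]
    have : Real.exp (-s ^ α) ≤ 1 := Real.exp_le_one_iff.mpr (by have := Real.rpow_nonneg hs α; linarith)
    nlinarith [Real.rpow_nonneg hs α]
  have hfirst : ‖∫ s in Ioc 0 a, eix y s * gfun α c s‖ ≤ |y| ^ (-1 - α) := by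
    have := norm_setIntegral_le_of_norm_le_const (μ := volume) (s := Ioc (0:ℝ) a) (C := a ^ α)
      (f := fun s => eix y s * gfun α c s) (by simp) ?_
    · refine this.trans ?_
      rw [← hpa]
      simp [ha0.le]
    · intro s hs
      rw [norm_mul, norm_eix, one_mul]
      exact (hgle s hs.1.le).trans (Real.rpow_le_rpow hs.1.le hs.2 hα0.le)
  have hyC : (y : ℂ) ≠ 0 := by exact_mod_cast hy
  have hp2 : IntegrableOn (fun s : ℝ => s ^ (α - 2)) (Ioi a) :=
    integrableOn_Ioi_rpow_of_lt (by linarith) ha0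
  have hg2 : IntegrableOn (gfun2 α c) (Ioi a) := by
    refine Integrable.mono' (hp2.const_mul (6 * (1 + ‖c‖) ^ 2))
      (measurable_gfun2 α c).aestronglyMeasurable ?_
    filter_upwards [ae_restrict_mem measurableSet_Ioi] with s hs
    exact norm_gfun2_le α hα0 hα1.le c hc s (ha0.trans hs)
  have hg2e := integrableOn_eix_mul y hg2
  have hga := hge.mono_set (Ioi_subset_Ioi ha0.le)
  set F : ℝ → ℂ := fun s => eix y s * (gfun α c s / (Complex.I * y) + gfun1 α c s / y ^ 2) with hF
  have hder : ∀ s ∈ Ici a, HasDerivAt F (eix y s * gfun α c s + eix y s * gfun2 α c s / y ^ 2) s := by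
    intro s hs
    have hs0 : 0 < s := lt_of_lt_of_le ha0 hs
    have he : HasDerivAt (eix y) (eix y s * (Complex.I * y)) s := by
      have := (((hasDerivAt_id s).ofReal_comp).const_mul (Complex.I * (y:ℂ))).cexp
      refine this.congr_deriv ?_
      simp [eix]
    refine (he.mul (((hasDerivAt_gfun α c s hs0).div_const (Complex.I * y)).add
      ((hasDerivAt_gfun1 α c s hs0).div_const ((y : ℂ) ^ 2)))).congr_deriv ?_
    have hI : Complex.I ≠ 0 := Complex.I_ne_zero
    have hI2 := Complex.I_sq
    simp only [Pi.add_apply]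
    field_simp
    linear_combination (eix y s * y * gfun1 α c s) * hI2
  have hFnorm : ∀ s, 0 < s → ‖F s‖ ≤ ‖gfun α c s‖ * a + 2 * (1 + ‖c‖) * s ^ (α - 1) * a ^ 2 := by
    intro s hs
    rw [hF]
    simp only
    rw [norm_mul, norm_eix, one_mul]
    refine (norm_add_le _ _).trans ?_
    rw [norm_div, norm_div, norm_mul, norm_pow, Complex.norm_I, Complex.norm_real, one_mul,
      Real.norm_eq_abs, div_eq_mul_inv, div_eq_mul_inv, ← ha, ← inv_pow, ← ha]
    gcongr
    exact norm_gfun1_le α hα0 hα1.le c hc s hs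
  have hlim : Tendsto F atTop (𝓝 0) := by
    refine squeeze_zero_norm' (a := fun s => ‖gfun α c s‖ * a + 2 * (1 + ‖c‖) * s ^ (α - 1) * a ^ 2) ?_ ?_
    · filter_upwards [eventually_gt_atTop 0] with s hs using hFnorm s hs
    · have t1 : Tendsto (fun s : ℝ => s ^ α * Real.exp (-s ^ α)) atTop (𝓝 0) := by
        have := (Real.tendsto_pow_mul_exp_neg_atTop_nhds_zero 1).comp (tendsto_rpow_atTop hα0)
        simpa [Function.comp_def] using this
      have t1' : Tendsto (fun s : ℝ => ‖gfun α c s‖) atTop (𝓝 0) := by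
        refine t1.congr' ?_
        filter_upwards [eventually_ge_atTop 0] with s hs using (norm_gfun α c hc s hs).symm
      have t2 : Tendsto (fun s : ℝ => s ^ (α - 1)) atTop (𝓝 0) := by
        have := tendsto_rpow_neg_atTop (y := 1 - α) (by linarith)
        simpa using this
      have := (t1'.mul_const a).add ((t2.const_mul (2 * (1 + ‖c‖))).mul_const (a ^ 2))
      simpa using this
  have hFTC := integral_Ioi_of_hasDerivAt_of_tendsto' hder (hga.add (hg2e.div_const _)) hlim
  rw [integral_add hga (hg2e.div_const _), integral_div] at hFTC
  have hsec : ∫ s in Ioi a, eix y s * gfun α c s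
      = - F a - (∫ s in Ioi a, eix y s * gfun2 α c s) / y ^ 2 := by
    linear_combination hFTC
  have ha1 : a ^ (α - 1) * a ^ 2 = |y| ^ (-1 - α) := by
    rw [← hpa, Real.rpow_sub_one ha0.ne']; field_simp
  have hFa : ‖F a‖ ≤ (1 + 2 * (1 + ‖c‖)) * |y| ^ (-1 - α) := by
    refine (hFnorm a ha0).trans ?_
    have h1 := mul_le_mul_of_nonneg_right (hgle a ha0.le) ha0.le
    rw [hpa] at h1
    rw [mul_assoc (2 * (1 + ‖c‖)), ha1]
    linarith
  have hlast : ‖(∫ s in Ioi a, eix y s * gfun2 α c s) / y ^ 2‖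
      ≤ 6 * (1 + ‖c‖) ^ 2 / (1 - α) * |y| ^ (-1 - α) := by
    have h1 : ‖∫ s in Ioi a, eix y s * gfun2 α c s‖ ≤ ∫ s in Ioi a, 6 * (1 + ‖c‖) ^ 2 * s ^ (α - 2) := by
      refine norm_integral_le_of_norm_le (hp2.const_mul _) ?_
      filter_upwards [ae_restrict_mem measurableSet_Ioi] with s hs
      rw [norm_mul, norm_eix, one_mul]
      exact norm_gfun2_le α hα0 hα1.le c hc s (ha0.trans hs)
    rw [integral_const_mul, integral_Ioi_rpow_of_lt (by linarith) ha0] at h1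
    have e : -a ^ (α - 2 + 1) / (α - 2 + 1) = a ^ (α - 1) / (1 - α) := by
      rw [show α - 2 + 1 = -(1 - α) by ring, neg_div_neg_eq, show -(1 - α) = α - 1 by ring]
    rw [e] at h1
    rw [norm_div, norm_pow, Complex.norm_real, Real.norm_eq_abs, div_eq_mul_inv, ← inv_pow, ← ha, ← ha1]
    calc _ ≤ 6 * (1 + ‖c‖) ^ 2 * (a ^ (α - 1) / (1 - α)) * a ^ 2 := by gcongr
      _ = _ := by ring
  rw [hsplit, hsec]
  calc _ ≤ ‖∫ s in Ioc 0 a, eix y s * gfun α c s‖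
        + (‖F a‖ + ‖(∫ s in Ioi a, eix y s * gfun2 α c s) / y ^ 2‖) := by
        refine (norm_add_le _ _).trans ?_
        gcongr
        refine (norm_sub_le _ _).trans ?_
        rw [norm_neg]
    _ ≤ |y| ^ (-1 - α) + ((1 + 2 * (1 + ‖c‖)) * |y| ^ (-1 - α)
        + 6 * (1 + ‖c‖) ^ 2 / (1 - α) * |y| ^ (-1 - α)) := by gcongr
    _ = _ := by ring

lemma decay_one (y : ℝ) :
    ‖∫ s in Ioi (0:ℝ), eix y s * gfun 1 1 s‖ = (1 + y ^ 2)⁻¹ := by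
  set b : ℂ := 1 - Complex.I * y with hb
  have hbn : ‖b‖ ^ 2 = 1 + y ^ 2 := by
    rw [← Complex.normSq_eq_norm_sq, Complex.normSq_apply]; simp [hb]; ring
  have hb0 : b ≠ 0 := by
    intro h; rw [h] at hbn; simp at hbn; nlinarith
  have heq : ∀ s : ℝ, eix y s * gfun 1 1 s = (s : ℂ) * Complex.exp (-(b * s)) := by
    intro s
    rw [gfun, eix, Real.rpow_one, mul_left_comm, ← Complex.exp_add]
    congr 2; rw [hb]; ring
  have hint : IntegrableOn (fun s : ℝ => (s : ℂ) * Complex.exp (-(b * s))) (Ioi 0) := by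
    have := integrableOn_eix_mul y (integrableOn_gfun 1 one_pos 1 (by simp))
    simpa only [heq] using this
  have hder : ∀ s ∈ Ici (0:ℝ), HasDerivAt (fun s : ℝ => -((s : ℂ) / b + 1 / b ^ 2) * Complex.exp (-(b * s)))
      ((s : ℂ) * Complex.exp (-(b * s))) s := by
    intro s _
    have h1 := (hasDerivAt_id s).ofReal_comp
    have h2 := (h1.const_mul b).neg.cexp
    refine ((((h1.div_const b).add_const (1 / b ^ 2)).neg).mul h2).congr_deriv ?_
    simp
    field_simp
    ring
  have hlim : Tendsto (fun s : ℝ => -((s : ℂ) / b + 1 / b ^ 2) * Complex.exp (-(b * s))) atTop (𝓝 0) := by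
    have hn : ∀ s : ℝ, ‖Complex.exp (-(b * s))‖ = Real.exp (-s) := by
      intro s; exact norm_cexp_neg b (by simp [hb]) s
    have t1 := Real.tendsto_pow_mul_exp_neg_atTop_nhds_zero 1
    have t0 := Real.tendsto_pow_mul_exp_neg_atTop_nhds_zero 0
    have t := (t1.const_mul (1 / ‖b‖)).add (t0.const_mul (1 / ‖b‖ ^ 2))
    simp only [mul_zero, add_zero] at t
    refine squeeze_zero_norm' ?_ t
    filter_upwards [eventually_ge_atTop 0] with s hs
    rw [norm_mul, norm_neg, hn]
    have : ‖(s : ℂ) / b + 1 / b ^ 2‖ ≤ s / ‖b‖ + 1 / ‖b‖ ^ 2 := by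
      refine (norm_add_le _ _).trans ?_
      simp [abs_of_nonneg hs]
    calc _ ≤ (s / ‖b‖ + 1 / ‖b‖ ^ 2) * Real.exp (-s) := by gcongr
      _ = _ := by ring
  have h := integral_Ioi_of_hasDerivAt_of_tendsto' hder hint hlim
  simp_rw [heq]
  rw [h]
  simp [hbn]

lemma decay (α : ℝ) (hα0 : 0 < α) (hα1 : α ≤ 1) (c : ℂ) (hc : c.re = 1) (h1 : α = 1 → c = 1) :
    ∃ C > 0, ∀ y : ℝ, ‖∫ s in Ioi (0:ℝ), eix y s * gfun α c s‖ ≤ C / (1 + |y|) ^ (α + 1) := by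
  rcases eq_or_lt_of_le hα1 with h | h
  · rw [h, h1 h]
    refine ⟨2, by norm_num, fun y => ?_⟩
    rw [decay_one]
    norm_num
    rw [inv_eq_one_div, div_le_div_iff₀ (by positivity) (by positivity)]
    nlinarith [sq_abs y, sq_nonneg (|y| - 1)]
  · set C0 := ∫ s in Ioi (0:ℝ), ‖gfun α c s‖ with hC0
    set C1 := 2 + 2 * (1 + ‖c‖) + 6 * (1 + ‖c‖) ^ 2 / (1 - α) with hC1
    have h1α : 0 < 1 - α := by linarith
    have hC1p : 0 < C1 := by positivity
    have hC0p : 0 ≤ C0 := integral_nonneg (fun _ => norm_nonneg _)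
    refine ⟨(C0 + C1) * 2 ^ (α + 1), by positivity, fun y => ?_⟩
    have hb0 : ‖∫ s in Ioi (0:ℝ), eix y s * gfun α c s‖ ≤ C0 := by
      refine (norm_integral_le_integral_norm _).trans (le_of_eq ?_)
      simp [norm_eix, hC0]
    rw [le_div_iff₀ (by positivity)]
    rcases le_total |y| 1 with hy | hy
    · have : (1 + |y|) ^ (α + 1) ≤ 2 ^ (α + 1) :=
        Real.rpow_le_rpow (by positivity) (by linarith) (by linarith)
      calc _ ≤ C0 * 2 ^ (α + 1) := by gcongr
        _ ≤ _ := by gcongr; linarith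
    · have hy0 : 0 < |y| := by linarith
      have hb1 := decay_lt_aux α hα0 h c hc y (abs_pos.mp hy0)
      rw [← hC1] at hb1
      have : (1 + |y|) ^ (α + 1) ≤ 2 ^ (α + 1) * |y| ^ (α + 1) := by
        rw [← Real.mul_rpow (by norm_num) hy0.le]
        exact Real.rpow_le_rpow (by positivity) (by linarith) (by linarith)
      have e : |y| ^ (-1 - α) * |y| ^ (α + 1) = 1 := by
        rw [← Real.rpow_add hy0]; ring_nf; simp
      calc _ ≤ (C1 * |y| ^ (-1 - α)) * (2 ^ (α + 1) * |y| ^ (α + 1)) := by gcongr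
        _ = C1 * 2 ^ (α + 1) * (|y| ^ (-1 - α) * |y| ^ (α + 1)) := by ring
        _ = C1 * 2 ^ (α + 1) := by rw [e, mul_one]
        _ ≤ _ := by gcongr; linarith

lemma decay_t (α : ℝ) (hα0 : 0 < α) (hα1 : α ≤ 1) (c : ℂ) (hc : c.re = 1) (h1 : α = 1 → c = 1) :
    ∃ C > 0, ∀ t : ℝ, 0 < t → ∀ x : ℝ,
      ‖∫ s in Ioi (0:ℝ), eix x s * (((s ^ α : ℝ) : ℂ) * Complex.exp (-((t : ℂ) * c * ((s ^ α : ℝ) : ℂ))))‖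
        ≤ C / (t ^ (1 / α) + |x|) ^ (α + 1) := by
  obtain ⟨C, hC, hb⟩ := decay α hα0 hα1 c hc h1
  refine ⟨C, hC, fun t ht x => ?_⟩
  set τ := t ^ (1 / α) with hτ
  have hτ0 : 0 < τ := Real.rpow_pos_of_pos ht _
  have hτα : τ ^ α = t := by
    rw [hτ, ← Real.rpow_mul ht.le, one_div_mul_cancel hα0.ne', Real.rpow_one]
  have hτC : (τ : ℂ) ≠ 0 := by exact_mod_cast hτ0.ne'
  have htC : (t : ℂ) ≠ 0 := by exact_mod_cast ht.ne'
  have heq : ∀ s ∈ Ioi (0:ℝ),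
      eix x s * (((s ^ α : ℝ) : ℂ) * Complex.exp (-((t : ℂ) * c * ((s ^ α : ℝ) : ℂ))))
      = (t : ℂ)⁻¹ * (fun s => eix (x / τ) s * gfun α c s) (τ * s) := by
    intro s hs
    have hs0 : (0:ℝ) < s := hs
    simp only [gfun, eix]
    rw [Real.mul_rpow hτ0.le hs0.le, hτα]
    have e1 : Complex.I * ((x / τ : ℝ) : ℂ) * ((τ * s : ℝ) : ℂ) = Complex.I * x * s := by
      push_cast; field_simp
    rw [e1]
    push_cast
    have e2 : -((t : ℂ) * c * ((s ^ α : ℝ) : ℂ)) = -(c * (t * ((s ^ α : ℝ) : ℂ))) := by ring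
    rw [e2]
    field_simp
  rw [setIntegral_congr_fun measurableSet_Ioi heq, integral_const_mul,
    integral_comp_mul_left_Ioi (fun s => eix (x / τ) s * gfun α c s) 0 hτ0, mul_zero, norm_mul, norm_smul]
  have hτp : τ ^ (α + 1) = t * τ := by rw [Real.rpow_add_one hτ0.ne', hτα]
  have hden : (τ + |x|) ^ (α + 1) = t * τ * (1 + |x / τ|) ^ (α + 1) := by
    rw [← hτp, ← Real.mul_rpow hτ0.le (by positivity)]
    congr 1
    rw [abs_div, abs_of_pos hτ0]; field_simp
  rw [hden, norm_inv, Complex.norm_real, Real.norm_of_nonneg ht.le, Real.norm_of_nonneg (by positivity)]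
  calc _ ≤ t⁻¹ * (τ⁻¹ * (C / (1 + |x / τ|) ^ (α + 1))) := by gcongr; exact hb _
    _ = _ := by field_simp
lemma integrable_comp_abs_of {f : ℝ → ℝ} (hf : IntegrableOn f (Ioi 0)) :
    Integrable (fun x => f |x|) := by
  have h1 : IntegrableOn (fun x => f |x|) (Ioi 0) := by
    refine hf.congr_fun ?_ measurableSet_Ioi
    intro x hx
    simp only
    rw [abs_of_pos (by exact hx)]
  have h2 : IntegrableOn (fun x ↦ f |x|) (Iic 0) := by
    rw [← Measure.map_neg_eq_self (volume : Measure ℝ)]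
    let m : MeasurableEmbedding fun x : ℝ => -x := (Homeomorph.neg ℝ).measurableEmbedding
    rw [m.integrableOn_map_iff]
    simp_rw [Function.comp_def, abs_neg, neg_preimage, neg_Iic, neg_zero]
    exact Iff.mpr integrableOn_Ici_iff_integrableOn_Ioi h1
  have := h2.union h1
  rwa [Iic_union_Ioi, integrableOn_univ] at this

lemma integrable_rpow_exp (α β t : ℝ) (hα0 : 0 < α) (hβ : -1 < β) (ht : 0 < t) :
    Integrable (fun l : ℝ => |l| ^ β * Real.exp (-t * |l| ^ α)) :=
  integrable_comp_abs_of (integrableOn_rpow_mul_exp_neg_mul_rpow hβ hα0 ht)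

lemma integrable_dom (β γ : ℝ) (hβ : -1 < β) (hγ : γ < -1) :
    Integrable (fun v : ℝ => if |v| ≤ 1 then |v| ^ β else |v| ^ γ) := by
  refine integrable_comp_abs_of (f := fun v => if v ≤ 1 then v ^ β else v ^ γ) ?_
  rw [← Ioc_union_Ioi_eq_Ioi zero_le_one]
  refine IntegrableOn.union ?_ ?_
  · have h : IntegrableOn (fun v : ℝ => v ^ β) (Ioc 0 1) :=
      (intervalIntegrable_iff_integrableOn_Ioc_of_le zero_le_one).mp
        (intervalIntegral.intervalIntegrable_rpow' hβ)
    refine h.congr_fun ?_ measurableSet_Ioc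
    intro v hv
    simp [hv.2]
  · refine (integrableOn_Ioi_rpow_of_lt hγ zero_lt_one).congr_fun ?_ measurableSet_Ioi
    intro v hv
    have : ¬ v ≤ 1 := not_le.mpr hv
    simp [this]

lemma homog_integral {E : Type*} [NormedAddCommGroup E] [NormedSpace ℝ E] (α : ℝ) (w : ℝ → ℝ)
    (hwh : ∀ s > 0, ∀ u, w (s * u) = s ^ (-1 - α) * w u) (k : ℝ → E) (s : ℝ) (hs : 0 < s) :
    ∫ u, w u • k (s * u) = s ^ α • ∫ v, w v • k v := by
  have h := Measure.integral_comp_mul_left (fun v => w v • k v) s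
  simp only [hwh s hs, mul_smul] at h
  rw [integral_smul, abs_of_pos (inv_pos.mpr hs)] at h
  have h2 := congrArg (fun z => s ^ (1 + α) • z) h
  simp only [smul_smul] at h2
  rw [← Real.rpow_add hs, show 1 + α + (-1 - α) = 0 by ring, Real.rpow_zero, one_smul] at h2
  rw [h2]
  congr 1
  rw [add_comm, Real.rpow_add_one hs.ne']
  field_simp

lemma homog_integrable {E : Type*} [NormedAddCommGroup E] [NormedSpace ℝ E] (α : ℝ) (w : ℝ → ℝ)
    (hwh : ∀ s > 0, ∀ u, w (s * u) = s ^ (-1 - α) * w u) (k : ℝ → E) (s : ℝ) (hs : 0 < s)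
    (hk : Integrable (fun v => w v • k v)) :
    Integrable (fun u => w u • k (s * u)) := by
  have h := hk.comp_mul_left' hs.ne'
  simp only [hwh s hs, mul_smul] at h
  have h2 := h.smul (s ^ (1 + α))
  refine h2.congr (Eventually.of_forall fun u => ?_)
  simp only [Pi.smul_apply, smul_smul]
  rw [← mul_assoc, ← Real.rpow_add hs, show 1 + α + (-1 - α) = 0 by ring, Real.rpow_zero, one_mul]

/-- The Fubini step. -/
lemma core_fubini (α t : ℝ) (hα0 : 0 < α) (ht : 0 < t) (w : ℝ → ℝ) (hw : Measurable w)
    (hwh : ∀ s > 0, ∀ u, w (s * u) = s ^ (-1 - α) * w u)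
    (k : ℝ → ℂ) (hk : Continuous k) (hk1 : Integrable (fun v => w v • k v))
    (hk2 : Integrable (fun v => w v • k (-v)))
    (Φ : ℝ → ℂ) (hΦ : Measurable Φ) (hΦn : ∀ l, ‖Φ l‖ = Real.exp (-t * |l| ^ α)) (x : ℝ) :
    ∫ u, w u • ∫ l, k (l * u) * (eix (-x) l * Φ l)
      = (∫ v, w v • k v) * (∫ l in Ioi (0:ℝ), eix (-x) l * (((l ^ α : ℝ) : ℂ) * Φ l))
        + (∫ v, w v • k (-v)) * (∫ l in Ioi (0:ℝ), eix x l * (((l ^ α : ℝ) : ℂ) * Φ (-l))) := by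
  set A := ∫ v, w v • k v with hA
  set B := ∫ v, w v • k (-v) with hB
  have hkn : ∀ l < 0, ∀ u, k (l * u) = (fun v => k (-v)) ((-l) * u) := by
    intro l _ u; simp
  set F : ℝ → ℝ → ℂ := fun u l => w u • (k (l * u) * (eix (-x) l * Φ l)) with hF
  have hFm : Measurable (Function.uncurry F) := by
    rw [hF]
    have h1 : Measurable k := hk.measurable
    have h2 : Measurable (eix (-x)) := (continuous_eix _).measurable
    exact (hw.comp measurable_fst).smul ((h1.comp (measurable_snd.mul measurable_fst)).mul
      ((h2.comp measurable_snd).mul (hΦ.comp measurable_snd)))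
  have hne : ∀ᵐ l : ℝ, l ≠ 0 := by
    simp [ae_iff, measure_singleton]
  have hFl : ∀ l : ℝ, ∀ u, F u l = (w u • k (l * u)) * (eix (-x) l * Φ l) := by
    intro l u; rw [hF]; simp only [smul_mul_assoc]
  have hint1 : ∀ l : ℝ, l ≠ 0 → Integrable (fun u => F u l) := by
    intro l hl
    simp_rw [hFl]
    refine Integrable.mul_const ?_ _
    rcases lt_or_gt_of_ne hl with h | h
    · simp_rw [hkn l h]
      exact homog_integrable α w hwh _ (-l) (by linarith) hk2
    · exact homog_integrable α w hwh k l h hk1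
  set D := (∫ v, ‖w v • k v‖) + ∫ v, ‖w v • k (-v)‖ with hD
  have hwabs : ∀ s > 0, ∀ u, |w (s * u)| = s ^ (-1 - α) * |w u| := by
    intro s hs u
    rw [hwh s hs, abs_mul, abs_of_pos (Real.rpow_pos_of_pos hs _)]
  have hnorm : ∀ l : ℝ, l ≠ 0 → ∫ u, ‖F u l‖ ≤ D * (|l| ^ α * Real.exp (-t * |l| ^ α)) := by
    intro l hl
    have e : ∀ u, ‖F u l‖ = (|w u| • ‖k (l * u)‖) * Real.exp (-t * |l| ^ α) := by
      intro u
      rw [hFl, norm_mul, norm_mul, norm_eix, one_mul, hΦn, norm_smul, Real.norm_eq_abs, smul_eq_mul]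
    simp_rw [e]
    rw [integral_mul_const, ← mul_assoc]
    refine mul_le_mul_of_nonneg_right ?_ (Real.exp_pos _).le
    have n1 : 0 ≤ ∫ v, ‖w v • k v‖ := integral_nonneg fun _ => norm_nonneg _
    have n2 : 0 ≤ ∫ v, ‖w v • k (-v)‖ := integral_nonneg fun _ => norm_nonneg _
    have n3 : 0 ≤ |l| ^ α := by positivity
    rcases lt_or_gt_of_ne hl with h | h
    · simp_rw [hkn l h]
      rw [homog_integral α (fun u => |w u|) hwabs (fun v => ‖k (-v)‖) (-l) (by linarith), abs_of_neg h]
      rw [abs_of_neg h] at n3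
      simp only [norm_smul, Real.norm_eq_abs, smul_eq_mul] at n1 n2 hD ⊢
      nlinarith
    · rw [homog_integral α (fun u => |w u|) hwabs (fun v => ‖k v‖) l h, abs_of_pos h]
      rw [abs_of_pos h] at n3
      simp only [norm_smul, Real.norm_eq_abs, smul_eq_mul] at n1 n2 hD ⊢
      nlinarith
  have hFint : Integrable (Function.uncurry F) (volume.prod volume) := by
    rw [integrable_prod_iff' hFm.aestronglyMeasurable]
    refine ⟨?_, ?_⟩
    · filter_upwards [hne] with l hl using hint1 l hl
    · refine Integrable.mono' ((integrable_rpow_exp α α t hα0 (by linarith) ht).const_mul D) ?_ ?_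
      · exact (hFm.norm.aestronglyMeasurable.prod_swap).integral_prod_right'
      · filter_upwards [hne] with l hl
        rw [Real.norm_of_nonneg (integral_nonneg fun _ => norm_nonneg _)]
        exact hnorm l hl
  have hLHS : ∫ u, w u • ∫ l, k (l * u) * (eix (-x) l * Φ l) = ∫ u, ∫ l, F u l := by
    congr 1; ext u
    rw [hF]; simp only; rw [integral_smul]
  rw [hLHS, integral_integral_swap hFint]
  have hin : Integrable (fun l => ∫ u, F u l) := hFint.integral_prod_right
  rw [← intervalIntegral.integral_Iic_add_Ioi (b := 0) hin.integrableOn hin.integrableOn, add_comm]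
  congr 1
  · rw [← integral_const_mul]
    refine setIntegral_congr_fun measurableSet_Ioi fun l hl => ?_
    simp only [hFl]
    rw [integral_mul_const, homog_integral α w hwh k l hl, Complex.real_smul]
    ring
  · have := integral_comp_neg_Ioi 0 (fun l => ∫ u, F u l)
    rw [neg_zero] at this
    rw [← this, ← integral_const_mul]
    refine setIntegral_congr_fun measurableSet_Ioi fun l hl => ?_
    have hl' : -l < 0 := neg_neg_of_pos hl
    simp only [hFl]
    have h5 : ∫ u, w u • k (-l * u) = l ^ α • B := by
      have := homog_integral α w hwh (fun v => k (-v)) l hl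
      simpa only [neg_mul] using this
    rw [integral_mul_const, h5, Complex.real_smul]
    have : eix (-x) (-l) = eix x l := by simp [eix]
    rw [this]
    ring

/-- Upper half exponent. -/
def cpl (α δ : ℝ) : ℂ := 1 - Complex.I * (δ : ℂ) * ((Real.tan (π * α / 2) : ℝ) : ℂ)

lemma cpl_re (α δ : ℝ) : (cpl α δ).re = 1 := by
  unfold cpl
  generalize Real.tan (π * α / 2) = T
  simp

lemma cpl_zero (α : ℝ) : cpl α 0 = 1 := by
  simp [cpl]

lemma stableCF_eq (α δ t l : ℝ) (h1 : α = 1 → δ = 0) :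
    stableCF α δ t l = Complex.exp ((↑(-(t * |l| ^ α)) : ℂ) *
    (1 - Complex.I * (δ : ℂ) * ((Real.sign l : ℝ) : ℂ) * ((Real.tan (π * α / 2) : ℝ) : ℂ))) := by
  rw [stableCF]
  split_ifs with h
  · rw [h1 h, h]; simp
  · rfl

lemma stableCF_pos (α δ t l : ℝ) (h1 : α = 1 → δ = 0) (hl : 0 < l) :
    stableCF α δ t l = Complex.exp (-((t : ℂ) * cpl α δ * ((l ^ α : ℝ) : ℂ))) := by
  rw [stableCF_eq α δ t l h1, Real.sign_of_pos hl, abs_of_pos hl, cpl]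
  congr 1
  push_cast
  ring

lemma stableCF_neg (α δ t l : ℝ) (h1 : α = 1 → δ = 0) (hl : 0 < l) :
    stableCF α δ t (-l) = Complex.exp (-((t : ℂ) * cpl α (-δ) * ((l ^ α : ℝ) : ℂ))) := by
  rw [stableCF_eq α δ t (-l) h1, Real.sign_of_neg (by linarith), abs_neg, abs_of_pos hl, cpl]
  congr 1
  push_cast
  ring

lemma stableCF_norm (α δ t l : ℝ) (h1 : α = 1 → δ = 0) :
    ‖stableCF α δ t l‖ = Real.exp (-t * |l| ^ α) := by
  rw [stableCF_eq α δ t l h1, Complex.norm_exp, Complex.re_ofReal_mul]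
  generalize Real.tan (π * α / 2) = T
  simp

lemma measurable_sign' : Measurable Real.sign := by
  unfold Real.sign
  exact Measurable.ite measurableSet_Iio measurable_const
    (Measurable.ite measurableSet_Ioi measurable_const measurable_const)

lemma stableCF_measurable (α δ t : ℝ) (h1 : α = 1 → δ = 0) : Measurable (stableCF α δ t) := by
  have : stableCF α δ t = _ := funext fun l => stableCF_eq α δ t l h1
  rw [this]
  have := measurable_sign'
  fun_prop

lemma stableCF_integrable (α δ t : ℝ) (hα0 : 0 < α) (ht : 0 < t) (h1 : α = 1 → δ = 0) :
    Integrable (stableCF α δ t) := by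
  refine Integrable.mono' (integrable_rpow_exp α 0 t hα0 (by norm_num) ht)
    (stableCF_measurable α δ t h1).aestronglyMeasurable ?_
  filter_upwards with l
  rw [stableCF_norm α δ t l h1]; simp

lemma inversion_s7 (f : ℝ → ℝ) (φ : ℝ → ℂ) (hf : Continuous f) (hφ : Integrable φ) (hφ0 : φ 0 ≠ 0)
    (h : ∀ l : ℝ, (∫ x : ℝ, Complex.exp (Complex.I * (l : ℂ) * (x : ℂ)) * ((f x : ℝ) : ℂ)) = φ l) (x : ℝ) :
    (f x : ℂ) = (2 * π : ℝ)⁻¹ • ∫ l, eix (-x) l * φ l := by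
  have hfi : Integrable (fun x => ((f x : ℝ) : ℂ)) := by
    by_contra hn
    have := h 0
    simp only [Complex.ofReal_zero, mul_zero, zero_mul, Complex.exp_zero, one_mul] at this
    rw [integral_undef hn] at this
    exact hφ0 this.symm
  have hF : FourierTransform.fourier (fun x => ((f x : ℝ) : ℂ)) = fun ξ => φ ((-(2 * π)) * ξ) := by
    ext ξ
    rw [Real.fourier_real_eq_integral_exp_smul, ← h]
    congr 1; ext v
    rw [smul_eq_mul]
    congr 2
    push_cast; ring
  have hpi : (-(2 * π)) ≠ 0 := by have := Real.pi_pos; linarith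
  have hFi : Integrable (FourierTransform.fourier (fun x => ((f x : ℝ) : ℂ))) := by
    rw [hF]; exact hφ.comp_mul_left' hpi
  have hinv := congrFun (Continuous.fourierInv_fourier_eq (Complex.continuous_ofReal.comp hf) hfi hFi) x
  simp only [Function.comp_apply] at hinv
  rw [← hinv]
  have hF' : FourierTransform.fourier (Complex.ofReal ∘ f) = fun ξ => φ ((-(2 * π)) * ξ) := hF
  rw [hF', Real.fourierInv_eq']
  have h3 := Measure.integral_comp_mul_left (fun l => eix (-x) l * φ l) (-(2 * π))
  rw [abs_inv, abs_neg, abs_of_pos (by positivity)] at h3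
  rw [← h3]
  congr 1; ext v
  rw [smul_eq_mul]
  congr 1
  rw [eix]
  congr 1
  simp
  ring

/-- The combined bound. -/
lemma core_bound (α δ : ℝ) (hα0 : 0 < α) (hα1 : α ≤ 1) (h1 : α = 1 → δ = 0)
    (w : ℝ → ℝ) (hw : Measurable w)
    (hwh : ∀ s > 0, ∀ u, w (s * u) = s ^ (-1 - α) * w u)
    (k : ℝ → ℂ) (hk : Continuous k) (hk1 : Integrable (fun v => w v • k v))
    (hk2 : Integrable (fun v => w v • k (-v))) :
    ∃ C > 0, ∀ t : ℝ, 0 < t → ∀ x : ℝ, ∀ f : ℝ → ℝ,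
      (∀ u, (f u : ℂ) = (2 * π : ℝ)⁻¹ • ∫ l, k (l * u) * (eix (-x) l * stableCF α δ t l)) →
      |∫ u, f u * w u| ≤ C / (t ^ (1 / α) + |x|) ^ (α + 1) := by
  obtain ⟨C1, hC1, hb1⟩ := decay_t α hα0 hα1 (cpl α δ) (cpl_re _ _) (fun h => by rw [h1 h, cpl_zero])
  obtain ⟨C2, hC2, hb2⟩ := decay_t α hα0 hα1 (cpl α (-δ)) (cpl_re _ _)
    (fun h => by rw [h1 h, neg_zero, cpl_zero])
  set A := ∫ v, w v • k v with hA
  set B := ∫ v, w v • k (-v) with hB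
  refine ⟨(2 * π)⁻¹ * (‖A‖ * C1 + ‖B‖ * C2) + 1, by positivity, fun t ht x f hf => ?_⟩
  have hfub := core_fubini α t hα0 ht w hw hwh k hk hk1 hk2 (stableCF α δ t)
    (stableCF_measurable α δ t h1) (fun l => stableCF_norm α δ t l h1) x
  have e1 : ∫ l in Ioi (0:ℝ), eix (-x) l * (((l ^ α : ℝ) : ℂ) * stableCF α δ t l)
      = ∫ s in Ioi (0:ℝ), eix (-x) s * (((s ^ α : ℝ) : ℂ) *
        Complex.exp (-((t : ℂ) * cpl α δ * ((s ^ α : ℝ) : ℂ)))) :=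
    setIntegral_congr_fun measurableSet_Ioi fun l hl => by
      rw [stableCF_pos α δ t l h1 hl]
  have e2 : ∫ l in Ioi (0:ℝ), eix x l * (((l ^ α : ℝ) : ℂ) * stableCF α δ t (-l))
      = ∫ s in Ioi (0:ℝ), eix x s * (((s ^ α : ℝ) : ℂ) *
        Complex.exp (-((t : ℂ) * cpl α (-δ) * ((s ^ α : ℝ) : ℂ)))) :=
    setIntegral_congr_fun measurableSet_Ioi fun l hl => by
      rw [stableCF_neg α δ t l h1 hl]
  rw [e1, e2] at hfub
  have hI : ((∫ u, f u * w u : ℝ) : ℂ) = (2 * π : ℝ)⁻¹ • ∫ u, w u • ∫ l, k (l * u) * (eix (-x) l * stableCF α δ t l) := by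
    rw [← integral_complex_ofReal, ← integral_smul]
    congr 1; ext u
    rw [Complex.ofReal_mul, hf u, smul_comm, mul_comm, ← Complex.real_smul]
  rw [← Real.norm_eq_abs, ← Complex.norm_real, hI, hfub, norm_smul, Real.norm_of_nonneg (by positivity)]
  have hd : 0 < (t ^ (1 / α) + |x|) ^ (α + 1) := by
    have := Real.rpow_pos_of_pos ht (1 / α)
    positivity
  have b1 := hb1 t ht (-x)
  have b2 := hb2 t ht x
  rw [abs_neg] at b1
  calc _ ≤ (2 * π)⁻¹ * (‖A‖ * (C1 / (t ^ (1 / α) + |x|) ^ (α + 1))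
        + ‖B‖ * (C2 / (t ^ (1 / α) + |x|) ^ (α + 1))) := by
        gcongr
        refine (norm_add_le _ _).trans ?_
        rw [norm_mul, norm_mul]
        gcongr
    _ = ((2 * π)⁻¹ * (‖A‖ * C1 + ‖B‖ * C2)) / (t ^ (1 / α) + |x|) ^ (α + 1) := by ring
    _ ≤ _ := by gcongr; linarith
lemma nuDens_measurable (α δ : ℝ) : Measurable (nuDens α δ) := by
  unfold nuDens
  refine Measurable.const_mul ?_ _
  exact Measurable.ite measurableSet_Ioi (by fun_prop)
    (Measurable.ite measurableSet_Iio (by fun_prop) measurable_const)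

lemma nuDens_homog (α δ : ℝ) : ∀ s > 0, ∀ u, nuDens α δ (s * u) = s ^ (-1 - α) * nuDens α δ u := by
  intro s hs u
  unfold nuDens
  rcases lt_trichotomy u 0 with h | h | h
  · have h2 : s * u < 0 := mul_neg_of_pos_of_neg hs h
    rw [if_neg (not_lt.mpr h2.le), if_pos h2, if_neg (not_lt.mpr h.le), if_pos h, abs_mul, abs_of_pos hs,
      Real.mul_rpow hs.le (abs_nonneg u)]
    ring
  · simp [h]
  · have h2 : 0 < s * u := mul_pos hs h
    rw [if_pos h2, if_pos h, Real.mul_rpow hs.le h.le]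
    ring

lemma nuDens_abs_le (α δ : ℝ) (hδ : δ ∈ Set.Ioo (-1 : ℝ) 1) (u : ℝ) :
    |nuDens α δ u| ≤ |dconst α| * |u| ^ (-1 - α) := by
  unfold nuDens
  rw [abs_mul]
  gcongr
  obtain ⟨h1, h2⟩ := hδ
  rcases lt_trichotomy u 0 with h | h | h
  · have hp := Real.rpow_pos_of_pos (abs_pos.mpr h.ne) (-1 - α)
    rw [if_neg (not_lt.mpr h.le), if_pos h, abs_mul, abs_of_pos hp, abs_of_pos (by linarith)]
    nlinarith
  · simp [h]; positivity
  · have hp := Real.rpow_pos_of_pos h (-1 - α)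
    rw [if_pos h, abs_mul, abs_of_pos hp, abs_of_pos (by linarith), abs_of_pos h]
    nlinarith

lemma integrable_of_dom (α β D : ℝ) (hα0 : 0 < α) (hβ : -1 < β) (w : ℝ → ℝ) (hw : Measurable w)
    (k : ℝ → ℂ) (hk : Continuous k)
    (h1 : ∀ v, |v| ≤ 1 → ‖w v • k v‖ ≤ D * |v| ^ β)
    (h2 : ∀ v, 1 < |v| → ‖w v • k v‖ ≤ D * |v| ^ (-1 - α)) :
    Integrable (fun v => w v • k v) := by
  refine Integrable.mono' ((integrable_dom β (-1 - α) hβ (by linarith)).const_mul D)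
    (hw.smul hk.measurable).aestronglyMeasurable ?_
  filter_upwards with v
  split_ifs with h
  · exact h1 v h
  · exact h2 v (not_le.mp h)

lemma kexp_integrable (α δ : ℝ) (hα0 : 0 < α) (hα1 : α < 1) (hδ : δ ∈ Set.Ioo (-1 : ℝ) 1) (e : ℝ)
    (he : |e| = 1) :
    Integrable (fun v => nuDens α δ v • (eix e v - 1)) := by
  refine integrable_of_dom α (-α) (2 * |dconst α|) hα0 (by linarith) _ (nuDens_measurable α δ)
    (fun v => eix e v - 1) ((continuous_eix e).sub continuous_const) ?_ ?_
  · intro v hv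
    rcases eq_or_ne v 0 with h | h
    · subst h
      simp [eix]
      positivity
    have hk : ‖eix e v - 1‖ ≤ |v| := by
      have := Real.norm_exp_I_mul_ofReal_sub_one_le (x := e * v)
      rw [Real.norm_eq_abs, abs_mul, he, one_mul] at this
      rw [eix]
      convert this using 4
      push_cast; ring
    rw [norm_smul, Real.norm_eq_abs]
    have hv0 : 0 < |v| := abs_pos.mpr h
    calc _ ≤ (|dconst α| * |v| ^ (-1 - α)) * |v| := by
          gcongr
          exact nuDens_abs_le α δ hδ v
      _ = |dconst α| * |v| ^ (-α) := by
          rw [mul_assoc, ← Real.rpow_add_one hv0.ne']; ring_nf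
      _ ≤ _ := by
          have : 0 ≤ |dconst α| * |v| ^ (-α) := by positivity
          linarith
  · intro v hv
    have hk : ‖eix e v - 1‖ ≤ 2 := by
      refine (norm_sub_le _ _).trans ?_
      rw [norm_eix]; norm_num
    rw [norm_smul, Real.norm_eq_abs]
    calc _ ≤ (|dconst α| * |v| ^ (-1 - α)) * 2 := by
          gcongr
          exact nuDens_abs_le α δ hδ v
      _ = _ := by ring

lemma kcos_integrable :
    Integrable (fun v : ℝ => ((1 / 2) * (1 / (π * v ^ 2))) • (((2 * Real.cos v - 2 : ℝ)) : ℂ)) := by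
  refine integrable_of_dom 1 0 4 one_pos (by norm_num) (fun v : ℝ => (1 / 2) * (1 / (π * v ^ 2)))
    (by fun_prop) (fun v => (((2 * Real.cos v - 2 : ℝ)) : ℂ)) (by fun_prop) ?_ ?_
  · intro v hv
    rw [norm_smul, Complex.norm_real, Real.norm_eq_abs, Real.norm_eq_abs, abs_of_nonneg (by positivity),
      Real.rpow_zero]
    have hk : |2 * Real.cos v - 2| ≤ v ^ 2 := by
      rw [abs_le]
      constructor
      · linarith [Real.one_sub_sq_div_two_le_cos (x := v)]
      · linarith [Real.cos_le_one v, sq_nonneg v]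
    rcases eq_or_ne v 0 with h | h
    · subst h; simp
    calc _ ≤ 1 / 2 * (1 / (π * v ^ 2)) * v ^ 2 := by gcongr
      _ = 1 / (2 * π) := by field_simp
      _ ≤ 1 / 1 := by
        gcongr
        linarith [Real.pi_gt_three]
      _ ≤ _ := by norm_num
  · intro v hv
    have hv0 : 0 < |v| := by linarith
    rw [norm_smul, Complex.norm_real, Real.norm_eq_abs, Real.norm_eq_abs, abs_of_nonneg (by positivity)]
    have hk : |2 * Real.cos v - 2| ≤ 4 := by
      rw [abs_le]
      constructor
      · linarith [Real.neg_one_le_cos v]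
      · linarith [Real.cos_le_one v]
    have e : |v| ^ (-1 - 1 : ℝ) = 1 / v ^ 2 := by
      rw [show (-1 - 1 : ℝ) = -(2 : ℕ) by norm_num, Real.rpow_neg hv0.le, Real.rpow_natCast, sq_abs, one_div]
    rw [e]
    have hv2 : 0 < v ^ 2 := by rw [← sq_abs]; positivity
    calc _ ≤ 1 / 2 * (1 / (π * v ^ 2)) * 4 := by gcongr
      _ ≤ 1 / 2 * (1 / (1 * v ^ 2)) * 4 := by
        gcongr
        linarith [Real.pi_gt_three]
      _ ≤ _ := by
        have : 0 < 1 / v ^ 2 := by positivity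
        rw [one_mul]; linarith

lemma eix_add_left (x u l : ℝ) : eix (-(x + u)) l = eix (-1) (l * u) * eix (-x) l := by
  rw [eix, eix, eix, ← Complex.exp_add]
  congr 1; push_cast; ring

lemma integrable_eix_mul (y : ℝ) {f : ℝ → ℂ} (hf : Integrable f) :
    Integrable (fun s => eix y s * f s) := by
  have := integrableOn_eix_mul (S := univ) y hf.integrableOn
  rwa [integrableOn_univ] at this

/-- Lemma 2.1 (2): `|L^{α,δ} p_t(x)| ≤ C_α/(t^{1/α}+|x|)^{α+1}`. -/
theorem stable_density_generator_bound
    (α δ : ℝ) (hα0 : 0 < α) (hα1 : α ≤ 1) (hδ : δ ∈ Set.Ioo (-1 : ℝ) 1)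
    (h1 : α = 1 → δ = 0)
    (p : ℝ → ℝ → ℝ)
    (hp : ∀ t : ℝ, 0 < t → (∀ x, 0 ≤ p t x) ∧ Continuous (p t) ∧
      ∀ l : ℝ, (∫ x : ℝ, Complex.exp (Complex.I * (l : ℂ) * (x : ℂ)) * ((p t x : ℝ) : ℂ))
        = stableCF α δ t l) :
    ∃ C > 0, ∀ t : ℝ, 0 < t → ∀ x : ℝ,
      |LopA α δ (p t) x| ≤ C / (t ^ (1/α) + |x|) ^ (α + 1) := by
  have hΦi : ∀ t, 0 < t → Integrable (stableCF α δ t) := fun t ht => stableCF_integrable α δ t hα0 ht h1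
  have hinv : ∀ t, 0 < t → ∀ x, (p t x : ℂ) = (2 * π : ℝ)⁻¹ • ∫ l, eix (-x) l * stableCF α δ t l := by
    intro t ht x
    refine inversion_s7 (p t) (stableCF α δ t) (hp t ht).2.1 (hΦi t ht) ?_ (hp t ht).2.2 x
    rw [stableCF_eq α δ t 0 h1]
    exact Complex.exp_ne_zero _
  rcases eq_or_lt_of_le hα1 with h | h
  · have hk := kcos_integrable
    obtain ⟨C, hC, hb⟩ := core_bound α δ hα0 hα1 h1 (fun v : ℝ => (1 / 2) * (1 / (π * v ^ 2)))
      (by fun_prop) (by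
        intro s hs u
        rw [h, show (-1 - 1 : ℝ) = -(2 : ℕ) by norm_num, Real.rpow_neg hs.le, Real.rpow_natCast]
        simp only [mul_pow, one_div, mul_inv]
        ring)
      (fun v => (((2 * Real.cos v - 2 : ℝ)) : ℂ)) (by fun_prop) hk (by simpa only [Real.cos_neg] using hk)
    refine ⟨C, hC, fun t ht x => ?_⟩
    rw [LopA, if_pos h, Lop1]
    have hd : 0 < (t ^ (1 / α) + |x|) ^ (α + 1) := by
      have := Real.rpow_pos_of_pos ht (1 / α)
      positivity
    set g : ℝ → ℝ := fun u => (p t (x + u) - p t x - (if |u| ≤ 1 then u * deriv (p t) x else 0))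
      * (1 / (π * u ^ 2)) with hg
    by_cases hgi : Integrable g
    · have hgn : Integrable (fun u => g (-u)) := hgi.comp_neg
      have e1 : ∫ u, g u = ∫ u, (p t (x + u) + p t (x + -u) - 2 * p t x) * ((1 / 2) * (1 / (π * u ^ 2))) := by
        have e2 : ∫ u, g u = (1 / 2) * ((∫ u, g u) + ∫ u, g (-u)) := by
          rw [integral_neg_eq_self g]; ring
        rw [e2, ← integral_add hgi hgn, ← integral_const_mul]
        congr 1; ext u
        simp only [hg, abs_neg]
        split_ifs <;> ring
      rw [e1]
      refine hb t ht x (fun u => p t (x + u) + p t (x + -u) - 2 * p t x) (fun u => ?_)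
      have i1 := integrable_eix_mul (-(x + u)) (hΦi t ht)
      have i2 := integrable_eix_mul (-(x + -u)) (hΦi t ht)
      have i3 := (integrable_eix_mul (-x) (hΦi t ht)).const_mul 2
      have i12 : Integrable (fun s => eix (-(x + u)) s * stableCF α δ t s
          + eix (-(x + -u)) s * stableCF α δ t s) := i1.add i2
      push_cast
      rw [hinv t ht, hinv t ht, hinv t ht, ← smul_add, mul_smul_comm, ← smul_sub, ← integral_add i1 i2,
        ← integral_const_mul, ← integral_sub i12 i3]
      congr 2; ext l
      simp only [eix_add_left]
      have : 2 * Complex.cos ((l : ℂ) * u) = eix (-1) (l * u) + eix (-1) (l * -u) := by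
        rw [Complex.two_cos, eix, eix, add_comm]
        congr 2 <;> (push_cast; ring)
      rw [this]
      ring
    · rw [integral_undef hgi, abs_zero]
      positivity
  · have hk := kexp_integrable α δ hα0 h hδ (-1) (by simp)
    have hk' := kexp_integrable α δ hα0 h hδ 1 (by simp)
    obtain ⟨C, hC, hb⟩ := core_bound α δ hα0 hα1 h1 (nuDens α δ) (nuDens_measurable α δ) (nuDens_homog α δ)
      (fun v => eix (-1) v - 1) ((continuous_eix _).sub continuous_const) hk (by
        refine hk'.congr (Eventually.of_forall fun v => ?_)
        simp [eix])
    refine ⟨C, hC, fun t ht x => ?_⟩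
    rw [LopA, if_neg h.ne, Lop]
    refine hb t ht x (fun u => p t (x + u) - p t x) (fun u => ?_)
    have i1 := integrable_eix_mul (-(x + u)) (hΦi t ht)
    have i3 := integrable_eix_mul (-x) (hΦi t ht)
    rw [Complex.ofReal_sub, hinv t ht, hinv t ht, ← smul_sub, ← integral_sub i1 i3]
    congr 2; ext l
    rw [eix_add_left]
    ring
end
end
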